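/- arXiv:2101.01682 — 2 statements merged into one kernel-verified Lean document; each statement's English description precedes it below -/
import Mathlib

section
/- Law of large numbers for squared increments in the bulk regime (Proposition A.1). Suppose x_n/n converges to some γ ∈ (i_p, Ψ(ρ)), where i_p = min{k : p(k)>0}, and let b ∈ (0,ρ) be such that Ψ(b) = γ. Then (1/n)·∑_{k=1}^n (X^n_k)² → (b²G''(b) + bG'(b))/G(b) in probability as n → ∞. -/
set_option autoImplicit false

open Filter Topology
open scoped Classical

/-- The generating function `G(s) = ∑_k p k s^k`. -/
noncomputable def genFun (p : ℕ → ℝ) (s : ℝ) : ℝ := ∑' k : ℕ, p k * s ^ k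

/-- `Ψ(b) = b G'(b) / G(b)`. -/
noncomputable def PsiFun (p : ℕ → ℝ) (b : ℝ) : ℝ :=
  b * deriv (genFun p) b / genFun p b

/-- Total weight `Z = ∑_{paths 0 → x in n nondecreasing steps} ∏ p(increments)`; paths are
encoded by their increment tuples, i.e. tuples `f : Fin n → ℕ` with `∑ f i = x`. -/
noncomputable def Zweight (p : ℕ → ℝ) (n x : ℕ) : ℝ :=
  ∑ f ∈ Finset.Nat.antidiagonalTuple n x, ∏ i, p (f i)

/-- `P^{p,n}_x(E)`: the probability, under the simply generated bridge law `P^{p,n}_x` on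
nondecreasing paths from `0` to `x` in `n` steps (encoded by increment tuples), of the
event `E`. -/
noncomputable def bridgeProb (p : ℕ → ℝ) (n x : ℕ) (E : (Fin n → ℕ) → Prop) : ℝ :=
  (∑ f ∈ (Finset.Nat.antidiagonalTuple n x).filter E, ∏ i, p (f i)) / Zweight p n x


/-- The character `u ↦ e^{iu}`. -/
noncomputable def ee (u : ℝ) : ℂ := Complex.exp (u * Complex.I)

/-- Characteristic function of the sequence `q`. -/
noncomputable def phi (q : ℕ → ℝ) (t : ℝ) : ℂ := ∑' k : ℕ, (q k : ℂ) * ee (t * k)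

lemma ee_add (u v : ℝ) : ee (u + v) = ee u * ee v := by
  unfold ee; rw [← Complex.exp_add]; push_cast; ring_nf

lemma ee_zero : ee 0 = 1 := by simp [ee]

lemma norm_ee (u : ℝ) : ‖ee u‖ = 1 := Complex.norm_exp_ofReal_mul_I u

lemma ee_neg_mul (u : ℝ) : ee (-u) * ee u = 1 := by
  rw [← ee_add]; simp [ee_zero]

lemma continuous_ee : Continuous ee := by
  unfold ee; fun_prop

lemma ee_natmul (u : ℝ) (n : ℕ) : ee (n * u) = ee u ^ n := by
  induction n with
  | zero => simp [ee_zero]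
  | succ n ih => rw [pow_succ, ← ih, ← ee_add]; push_cast; ring_nf

lemma ee_sum {ι : Type*} (s : Finset ι) (f : ι → ℝ) : ee (∑ i ∈ s, f i) = ∏ i ∈ s, ee (f i) := by
  induction s using Finset.induction_on with
  | empty => simp [ee_zero]
  | insert a s ha ih => rw [Finset.sum_insert ha, Finset.prod_insert ha, ee_add, ih]

lemma norm_ee_sub_one (u : ℝ) : ‖ee u - 1‖ = |2 * Real.sin (u / 2)| := by
  have := Complex.norm_exp_I_mul_ofReal_sub_one u
  rw [Real.norm_eq_abs] at this
  rw [← this, ee, mul_comm]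

lemma norm_ee_sub_one_ge (t : ℝ) (ht : |t| ≤ Real.pi) : 2 / Real.pi * |t| ≤ ‖ee t - 1‖ := by
  rw [norm_ee_sub_one]
  have h : |t / 2| ≤ Real.pi / 2 := by
    rw [abs_div, abs_two]; linarith
  have := Real.mul_abs_le_abs_sin h
  rw [abs_div, abs_two] at this
  rw [abs_mul, abs_two]
  linarith

lemma norm_ee_add_le (a b : ℝ) : ‖ee a + ee b‖ ≤ 2 - ‖ee (a - b) - 1‖ ^ 2 / 4 := by
  have h1 : ‖ee a + ee b‖ = ‖ee (a - b) + 1‖ := by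
    have : ee a + ee b = (ee (a - b) + 1) * ee b := by
      rw [add_mul, ← ee_add]; simp
    rw [this, norm_mul, norm_ee, mul_one]
  rw [h1]
  have h2 := parallelogram_law_with_norm ℝ (ee (a - b)) 1
  rw [norm_ee, norm_one] at h2
  have hA := norm_nonneg (ee (a - b) + 1)
  have hB := norm_nonneg (ee (a - b) - 1)
  set A := ‖ee (a - b) + 1‖
  set B := ‖ee (a - b) - 1‖
  apply abs_le_of_sq_le_sq' _ _ |>.2
  · nlinarith [sq_nonneg (B ^ 2)]
  · nlinarith [sq_nonneg A]

lemma integral_ee (m : ℤ) : ∫ t in (-Real.pi)..Real.pi, ee (t * m) =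
    if m = 0 then (2 * Real.pi : ℂ) else 0 := by
  split_ifs with h
  · subst h; simp [ee_zero]; ring
  · have hc : (m * Complex.I : ℂ) ≠ 0 := by
      simp [h]
    have : ∀ t : ℝ, ee (t * m) = Complex.exp ((m * Complex.I) * t) := by
      intro t; unfold ee; push_cast; ring_nf
    simp_rw [this]
    rw [integral_exp_mul_complex hc]
    have e : Complex.exp ((m * Complex.I) * (Real.pi : ℝ)) =
        Complex.exp ((m * Complex.I) * ((-Real.pi : ℝ) : ℂ)) := by
      rw [Complex.exp_eq_exp_iff_exists_int]
      exact ⟨m, by push_cast; ring⟩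
    rw [e]; simp

lemma fourier_finite (q : ℕ → ℝ) (n x N : ℕ) (hN : x < N) :
    ∫ t in (-Real.pi)..Real.pi,
      (∑ k ∈ Finset.range N, (q k : ℂ) * ee (t * k)) ^ n * ee (-(t * x)) =
      2 * Real.pi * (Zweight q n x : ℂ) := by
  have h1 : ∀ t : ℝ, (∑ k ∈ Finset.range N, (q k : ℂ) * ee (t * k)) ^ n * ee (-(t * x)) =
      ∑ f ∈ Fintype.piFinset (fun _ : Fin n => Finset.range N),
        (∏ i, (q (f i) : ℂ)) * ee (t * (((∑ i, f i : ℕ) : ℤ) - x : ℤ)) := by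
    intro t
    have := Finset.prod_univ_sum (fun _ : Fin n => Finset.range N)
      (fun _ k => (q k : ℂ) * ee (t * k))
    rw [Finset.prod_const, Finset.card_univ, Fintype.card_fin] at this
    rw [this, Finset.sum_mul]
    refine Finset.sum_congr rfl fun f _ => ?_
    rw [Finset.prod_mul_distrib, ← ee_sum, mul_assoc, ← ee_add, ← Finset.mul_sum]
    congr 2
    push_cast; ring
  simp_rw [h1]
  rw [intervalIntegral.integral_finsetSum]
  · simp_rw [intervalIntegral.integral_const_mul, integral_ee]
    unfold Zweight
    push_cast
    rw [Finset.mul_sum]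
    simp_rw [mul_ite, mul_zero]
    rw [← Finset.sum_filter]
    symm
    have hset : Finset.Nat.antidiagonalTuple n x = (Fintype.piFinset
        (fun _ : Fin n => Finset.range N)).filter
        (fun f => (∑ i, (f i : ℤ)) - (x : ℤ) = 0) := by
      ext f
      simp only [Finset.Nat.mem_antidiagonalTuple, Finset.mem_filter, Fintype.mem_piFinset,
        Finset.mem_range]
      constructor
      · intro h
        refine ⟨fun i => ?_, ?_⟩
        · have := Finset.single_le_sum (f := f) (fun i _ => Nat.zero_le _) (Finset.mem_univ i)
          omega
        · rw [← h]; push_cast; ring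
      · rintro ⟨_, h⟩
        have : ((∑ i, f i : ℕ) : ℤ) = x := by push_cast; linarith
        exact_mod_cast this
    rw [hset]
    exact Finset.sum_congr rfl fun f _ => by ring
  · intro f _
    apply Continuous.intervalIntegrable
    exact continuous_const.mul (continuous_ee.comp (by fun_prop))

lemma summable_phi {q : ℕ → ℝ} (hq0 : ∀ k, 0 ≤ q k) (hq : Summable q) (t : ℝ) :
    Summable (fun k : ℕ => (q k : ℂ) * ee (t * k)) := by
  apply Summable.of_norm
  simpa [norm_ee, abs_of_nonneg (hq0 _)] using hq

lemma continuous_phi {q : ℕ → ℝ} (hq0 : ∀ k, 0 ≤ q k) (hq : Summable q) :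
    Continuous (phi q) := by
  apply continuous_tsum (u := q) _ hq
  · intro n x
    simp [norm_ee, abs_of_nonneg (hq0 _)]
  · intro k
    exact continuous_const.mul (continuous_ee.comp (by fun_prop))

lemma fourier_inv {q : ℕ → ℝ} (hq0 : ∀ k, 0 ≤ q k) (hq : HasSum q 1) (n x : ℕ) :
    ∫ t in (-Real.pi)..Real.pi, (phi q t) ^ n * ee (-(t * x)) =
      2 * Real.pi * (Zweight q n x : ℂ) := by
  have h := intervalIntegral.tendsto_integral_filter_of_dominated_convergence
    (a := -Real.pi) (b := Real.pi) (μ := MeasureTheory.volume) (l := atTop)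
    (F := fun (N : ℕ) (t : ℝ) =>
      (∑ k ∈ Finset.range N, (q k : ℂ) * ee (t * k)) ^ n * ee (-(t * x)))
    (f := fun t => (phi q t) ^ n * ee (-(t * x))) (fun _ => (1 : ℝ)) ?_ ?_ ?_ ?_
  · refine tendsto_nhds_unique h ?_
    refine tendsto_const_nhds.congr' ?_
    filter_upwards [eventually_gt_atTop x] with N hN
    exact (fourier_finite q n x N hN).symm
  · refine Eventually.of_forall fun N => ?_
    apply Continuous.aestronglyMeasurable
    refine Continuous.mul (Continuous.pow (continuous_finsetSum _ fun k _ => ?_) n) ?_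
    · exact continuous_const.mul (continuous_ee.comp (by fun_prop))
    · exact (continuous_ee.comp (by fun_prop))
  · refine Eventually.of_forall fun N => Eventually.of_forall fun t _ => ?_
    rw [norm_mul, norm_ee, mul_one, norm_pow]
    apply pow_le_one₀ (norm_nonneg _)
    refine (norm_sum_le _ _).trans ?_
    simp only [norm_mul, norm_ee, mul_one, Complex.norm_real, Real.norm_eq_abs,
      abs_of_nonneg (hq0 _)]
    exact sum_le_hasSum _ (fun i _ => hq0 i) hq
  · exact continuous_const.intervalIntegrable _ _
  · refine Eventually.of_forall fun t _ => ?_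
    exact (((summable_phi hq0 hq.summable t).hasSum.tendsto_sum_nat).pow n).mul_const _

/-- Bound on `|phi|` from one pair of atoms. -/
lemma norm_phi_le_pair {q : ℕ → ℝ} (hq0 : ∀ k, 0 ≤ q k) (hq : HasSum q 1) (a b : ℕ) (δ : ℝ)
    (hδ : 0 ≤ δ) (ha : δ ≤ q a) (hb : δ ≤ q b) (t : ℝ) :
    ‖phi q t‖ ≤ 1 - δ / 4 * ‖ee (t * ((a : ℝ) - b)) - 1‖ ^ 2 := by
  have h1 : ‖phi q t‖ ≤ 1 := by
    have := norm_tsum_le_tsum_norm (summable_phi hq0 hq.summable t).norm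
    simp only [norm_mul, norm_ee, mul_one, Complex.norm_real, Real.norm_eq_abs,
      abs_of_nonneg (hq0 _), hq.tsum_eq] at this
    exact this
  by_cases hab : a = b
  · subst hab; simpa [ee_zero] using h1
  let r : ℕ → ℝ := fun k => (if k = a then δ else 0) + (if k = b then δ else 0)
  have hr : HasSum r (δ + δ) := (hasSum_ite_eq a δ).add (hasSum_ite_eq b δ)
  have hqr : HasSum (fun k => q k - r k) (1 - (δ + δ)) := hq.sub hr
  have hqr0 : ∀ k, 0 ≤ q k - r k := by
    intro k
    simp only [r]
    split_ifs with h1 h2 h2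
    · exact absurd (h1.symm.trans h2) hab
    · subst h1; linarith
    · subst h2; linarith
    · linarith [hq0 k]
  have e1 : HasSum (fun k : ℕ => (r k : ℂ) * ee (t * k)) (δ * ee (t * a) + δ * ee (t * b)) := by
    have := (hasSum_ite_eq a ((δ : ℂ) * ee (t * a))).add (hasSum_ite_eq b ((δ : ℂ) * ee (t * b)))
    refine this.congr_fun ?_ |> id
    intro k
    simp only [r]
    split_ifs with h1 h2 h2 <;> simp_all
  have e2 := (summable_phi hqr0 hqr.summable t).hasSum
  have e3 : phi q t = (δ * ee (t * a) + δ * ee (t * b)) +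
      ∑' k : ℕ, ((q k - r k : ℝ) : ℂ) * ee (t * k) := by
    rw [← (e1.add e2).tsum_eq]
    unfold phi
    congr 1; ext k; push_cast; ring
  rw [e3]
  refine (norm_add_le _ _).trans ?_
  have b1 : ‖(δ : ℂ) * ee (t * a) + δ * ee (t * b)‖ ≤
      δ * (2 - ‖ee (t * ((a : ℝ) - b)) - 1‖ ^ 2 / 4) := by
    rw [← mul_add, norm_mul, Complex.norm_real, Real.norm_eq_abs, abs_of_nonneg hδ]
    have := norm_ee_add_le (t * a) (t * b)
    rw [← mul_sub] at this
    gcongr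
  have b2 : ‖∑' k : ℕ, ((q k - r k : ℝ) : ℂ) * ee (t * k)‖ ≤ 1 - (δ + δ) := by
    have := norm_tsum_le_tsum_norm (summable_phi hqr0 hqr.summable t).norm
    simp only [norm_mul, norm_ee, mul_one, Complex.norm_real, Real.norm_eq_abs,
      abs_of_nonneg (hqr0 _), hqr.tsum_eq] at this
    exact this
  linarith

/-- Aperiodicity, in quantitative form. -/
lemma aperiodic_bound (p : ℕ → ℝ)
    (hp : ¬ ∃ (a h : ℤ), 2 ≤ h ∧ ∀ k : ℕ, 0 < p k → h ∣ ((k : ℤ) - a)) :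
    ∃ (C : ℝ) (F : Finset (ℕ × ℕ)), 0 < C ∧ (∀ z ∈ F, 0 < p z.1 ∧ 0 < p z.2) ∧
      ∀ t : ℝ, ∃ z ∈ F, ‖ee t - 1‖ ≤ C * ‖ee (t * ((z.1 : ℝ) - z.2)) - 1‖ := by
  obtain ⟨k₀, hk₀⟩ : ∃ k, 0 < p k := by
    by_contra hcon
    push Not at hcon
    exact hp ⟨0, 2, le_rfl, fun k hk => absurd hk (not_lt.2 (hcon k))⟩
  let S : Set ℤ := {d | ∃ k l : ℕ, 0 < p k ∧ 0 < p l ∧ d = k - l}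
  have hmem : (1 : ℤ) ∈ AddSubgroup.closure S := by
    obtain ⟨g, hg⟩ := Int.subgroup_cyclic (AddSubgroup.closure S)
    have hdvd : ∀ k : ℕ, 0 < p k → g ∣ ((k : ℤ) - k₀) := by
      intro k hk
      have : ((k : ℤ) - k₀) ∈ AddSubgroup.closure S :=
        AddSubgroup.subset_closure ⟨k, k₀, hk, hk₀, rfl⟩
      rw [hg, AddSubgroup.mem_closure_singleton] at this
      obtain ⟨m, hm⟩ := this
      exact ⟨m, by rw [← hm]; simp [mul_comm]⟩
    rw [hg, AddSubgroup.mem_closure_singleton]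
    by_cases h0 : g = 0
    · exfalso
      refine hp ⟨k₀, 2, le_rfl, fun k hk => ?_⟩
      have := hdvd k hk
      rw [h0, zero_dvd_iff] at this
      rw [this]; exact dvd_zero _
    · have : |g| = 1 := by
        by_contra h1
        have h2 : 0 < |g| := abs_pos.2 h0
        exact hp ⟨k₀, |g|, by omega, fun k hk => (abs_dvd _ _).2 (hdvd k hk)⟩
      rcases abs_eq (zero_le_one) |>.1 this with h | h
      · exact ⟨1, by simp [h]⟩
      · exact ⟨-1, by simp [h]⟩
  have key : ∀ d : ℤ, d ∈ AddSubgroup.closure S →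
      ∃ (C : ℝ) (F : Finset (ℕ × ℕ)), 0 < C ∧ (∀ z ∈ F, 0 < p z.1 ∧ 0 < p z.2) ∧
      ∀ t : ℝ, ∃ z ∈ F, ‖ee (t * d) - 1‖ ≤ C * ‖ee (t * ((z.1 : ℝ) - z.2)) - 1‖ := by
    intro d hd
    induction hd using AddSubgroup.closure_induction with
    | mem d hd =>
      obtain ⟨k, l, hk, hl, rfl⟩ := hd
      refine ⟨1, {(k, l)}, one_pos, by simp [hk, hl], fun t => ⟨(k, l), by simp, ?_⟩⟩
      push_cast; simp
    | zero =>
      refine ⟨1, {(k₀, k₀)}, one_pos, by simp [hk₀], fun t => ⟨(k₀, k₀), by simp, ?_⟩⟩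
      simp [ee_zero]
    | neg d _ ih =>
      obtain ⟨C, F, hC, hF, h⟩ := ih
      refine ⟨C, F, hC, hF, fun t => ?_⟩
      obtain ⟨z, hz, h1⟩ := h t
      refine ⟨z, hz, le_trans (le_of_eq ?_) h1⟩
      rw [norm_ee_sub_one, norm_ee_sub_one]
      push_cast
      rw [mul_neg, neg_div, Real.sin_neg, mul_neg, abs_neg]
    | add d e _ _ ih1 ih2 =>
      obtain ⟨C, F, hC, hF, h⟩ := ih1
      obtain ⟨C', F', hC', hF', h'⟩ := ih2
      refine ⟨C + C', F ∪ F', by positivity, ?_, fun t => ?_⟩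
      · intro z hz
        rcases Finset.mem_union.1 hz with hz | hz
        · exact hF z hz
        · exact hF' z hz
      obtain ⟨z, hz, h1⟩ := h t
      obtain ⟨z', hz', h1'⟩ := h' t
      have htri : ‖ee (t * ((d + e : ℤ) : ℝ)) - 1‖ ≤ ‖ee (t * d) - 1‖ + ‖ee (t * e) - 1‖ := by
        have : ee (t * ((d + e : ℤ) : ℝ)) - 1 = (ee (t * d) - 1) * ee (t * e) + (ee (t * e) - 1) := by
          push_cast
          rw [mul_add, ee_add]; ring
        rw [this]
        refine (norm_add_le _ _).trans ?_
        rw [norm_mul, norm_ee, mul_one]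
      rcases le_total (‖ee (t * ((z.1 : ℝ) - z.2)) - 1‖) (‖ee (t * ((z'.1 : ℝ) - z'.2)) - 1‖)
        with hle | hle
      · refine ⟨z', Finset.mem_union_right _ hz', ?_⟩
        have := mul_le_mul_of_nonneg_left hle hC.le
        linarith
      · refine ⟨z, Finset.mem_union_left _ hz, ?_⟩
        have := mul_le_mul_of_nonneg_left hle hC'.le
        linarith
  simpa using key 1 hmem

/-- Gaussian decay of `phi` on `[-π, π]`, uniformly in `q` bounded below on `F`. -/
lemma phi_decay {q : ℕ → ℝ} (hq0 : ∀ k, 0 ≤ q k) (hq : HasSum q 1) (C δ : ℝ) (hC : 0 < C)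
    (hδ : 0 < δ) (F : Finset (ℕ × ℕ)) (hF : ∀ z ∈ F, δ ≤ q z.1 ∧ δ ≤ q z.2)
    (h : ∀ t : ℝ, ∃ z ∈ F, ‖ee t - 1‖ ≤ C * ‖ee (t * ((z.1 : ℝ) - z.2)) - 1‖)
    (t : ℝ) (ht : |t| ≤ Real.pi) :
    ‖phi q t‖ ≤ Real.exp (-(δ / (C ^ 2 * Real.pi ^ 2)) * t ^ 2) := by
  obtain ⟨z, hz, h1⟩ := h t
  have h2 := norm_phi_le_pair hq0 hq z.1 z.2 δ hδ.le (hF z hz).1 (hF z hz).2 t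
  have h3 := norm_ee_sub_one_ge t ht
  have h4 := h3.trans h1
  have hpi := Real.pi_pos
  set B := ‖ee (t * ((z.1 : ℝ) - z.2)) - 1‖
  have h5 : (2 / Real.pi * |t|) ^ 2 ≤ (C * B) ^ 2 := pow_le_pow_left₀ (by positivity) h4 2
  have h6 : δ / (C ^ 2 * Real.pi ^ 2) * t ^ 2 ≤ δ / 4 * B ^ 2 := by
    rw [mul_pow, mul_pow, sq_abs, div_pow] at h5
    have e : δ / (C ^ 2 * Real.pi ^ 2) * t ^ 2 = δ / (4 * C ^ 2) * (2 ^ 2 / Real.pi ^ 2 * t ^ 2) := by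
      field_simp; ring
    have e' : δ / 4 * B ^ 2 = δ / (4 * C ^ 2) * (C ^ 2 * B ^ 2) := by
      field_simp
    rw [e, e']
    gcongr
  have h7 := Real.add_one_le_exp (-(δ / (C ^ 2 * Real.pi ^ 2)) * t ^ 2)
  linarith

lemma ee_taylor (u : ℝ) : ‖ee u - 1 - u * Complex.I + u ^ 2 / 2‖ ≤ 4 * |u| ^ 3 := by
  have hn : ‖(u * Complex.I : ℂ)‖ = |u| := by simp
  by_cases hu : |u| ≤ 1
  · have h := Complex.exp_bound (x := u * Complex.I) (by rw [hn]; exact hu) (n := 3) (by norm_num)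
    rw [hn] at h
    have e : ee u - 1 - u * Complex.I + u ^ 2 / 2 = Complex.exp (u * Complex.I) -
        ∑ m ∈ Finset.range 3, (u * Complex.I : ℂ) ^ m / (m.factorial : ℂ) := by
      simp only [Finset.sum_range_succ, Finset.sum_range_zero, ee, mul_pow, Complex.I_sq]
      norm_num [Nat.factorial]
      ring
    rw [e]
    refine h.trans ?_
    norm_num [Nat.factorial]
    nlinarith [pow_nonneg (abs_nonneg u) 3]
  · push Not at hu
    have h1 : ‖ee u - 1 - u * Complex.I + u ^ 2 / 2‖ ≤ 1 + 1 + |u| + |u| ^ 2 / 2 := by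
      refine (norm_add_le _ _).trans ?_
      refine add_le_add ((norm_sub_le _ _).trans (add_le_add ((norm_sub_le _ _).trans ?_) hn.le)) ?_
      · rw [norm_ee, norm_one]
      · simp
    have h2 : |u| ≤ |u| ^ 3 := le_self_pow₀ hu.le (by norm_num)
    have h3 : |u| ^ 2 ≤ |u| ^ 3 := pow_le_pow_right₀ hu.le (by norm_num)
    linarith

lemma exp_le_quad (u : ℝ) (hu : u ≤ 1) : Real.exp u ≤ 1 + u + u ^ 2 := by
  by_cases h : -1 ≤ u
  · have := Real.abs_exp_sub_one_sub_id_le (abs_le.2 ⟨h, hu⟩)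
    have := (abs_le.1 this).2
    linarith
  · push Not at h
    have := Real.exp_le_one_iff.2 (show u ≤ 0 by linarith)
    nlinarith

lemma norm_pow_sub_pow_le' (a b : ℂ) (ha : ‖a‖ ≤ 1) (hb : ‖b‖ ≤ 1) (n : ℕ) :
    ‖a ^ n - b ^ n‖ ≤ n * ‖a - b‖ := by
  induction n with
  | zero => simp
  | succ n ih =>
    have e : a ^ (n + 1) - b ^ (n + 1) = (a ^ n - b ^ n) * a + b ^ n * (a - b) := by ring
    rw [e]
    refine (norm_add_le _ _).trans ?_
    rw [norm_mul, norm_mul, norm_pow]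
    have h1 : ‖a ^ n - b ^ n‖ * ‖a‖ ≤ ‖a ^ n - b ^ n‖ * 1 := by gcongr
    have h2 : ‖b‖ ^ n * ‖a - b‖ ≤ 1 * ‖a - b‖ := by
      gcongr; exact pow_le_one₀ (norm_nonneg _) hb
    push_cast
    linarith

lemma norm_phi_le_one {q : ℕ → ℝ} (hq0 : ∀ k, 0 ≤ q k) (hq : HasSum q 1) (t : ℝ) :
    ‖phi q t‖ ≤ 1 := by
  simpa using norm_phi_le_pair hq0 hq 0 0 0 le_rfl (hq0 0) (hq0 0) t

lemma phi_expansion {q : ℕ → ℝ} (hq0 : ∀ k, 0 ≤ q k) (hq : HasSum q 1) (μ v w : ℝ)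
    (h1 : HasSum (fun k : ℕ => q k * ((k : ℝ) - μ)) 0)
    (h2 : HasSum (fun k : ℕ => q k * ((k : ℝ) - μ) ^ 2) v)
    (h3 : HasSum (fun k : ℕ => q k * |(k : ℝ) - μ| ^ 3) w) (t : ℝ) :
    ‖phi q t * ee (-(t * μ)) - (1 - v * t ^ 2 / 2 : ℝ)‖ ≤ 4 * w * |t| ^ 3 := by
  have a0 : HasSum (fun k : ℕ => (q k : ℂ) * ee (t * ((k : ℝ) - μ))) (phi q t * ee (-(t * μ))) := by
    have := (summable_phi hq0 hq.summable t).hasSum.mul_right (ee (-(t * μ)))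
    refine this.congr_fun fun k => ?_
    rw [mul_assoc, ← ee_add]; congr 2; ring
  have b0 := Complex.hasSum_ofReal.2 hq
  have b1 := (Complex.hasSum_ofReal.2 h1).mul_left (t * Complex.I)
  have b2 := (Complex.hasSum_ofReal.2 h2).mul_left ((t : ℂ) ^ 2 / 2)
  have c := ((a0.sub b0).sub b1).add b2
  have e : phi q t * ee (-(t * μ)) - (1 - v * t ^ 2 / 2 : ℝ) =
      phi q t * ee (-(t * μ)) - ((1 : ℝ) : ℂ) - (t * Complex.I) * ((0 : ℝ) : ℂ) +
        (t : ℂ) ^ 2 / 2 * (v : ℂ) := by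
    push_cast; ring
  rw [e]
  have d := h3.mul_left (4 * |t| ^ 3)
  have bd : ∀ k : ℕ, ‖((q k : ℂ) * ee (t * ((k : ℝ) - μ)) - (q k : ℂ) -
      (t * Complex.I) * ((q k * ((k : ℝ) - μ) : ℝ) : ℂ) +
      (t : ℂ) ^ 2 / 2 * ((q k * ((k : ℝ) - μ) ^ 2 : ℝ) : ℂ))‖ ≤
      4 * |t| ^ 3 * (q k * |(k : ℝ) - μ| ^ 3) := by
    intro k
    have e1 : ((q k : ℂ) * ee (t * ((k : ℝ) - μ)) - (q k : ℂ) -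
      (t * Complex.I) * ((q k * ((k : ℝ) - μ) : ℝ) : ℂ) +
      (t : ℂ) ^ 2 / 2 * ((q k * ((k : ℝ) - μ) ^ 2 : ℝ) : ℂ)) = (q k : ℂ) *
      (ee (t * ((k : ℝ) - μ)) - 1 - ((t * ((k : ℝ) - μ) : ℝ) : ℂ) * Complex.I +
        ((t * ((k : ℝ) - μ) : ℝ) : ℂ) ^ 2 / 2) := by
      push_cast; ring
    rw [e1, norm_mul, Complex.norm_real, Real.norm_eq_abs, abs_of_nonneg (hq0 k)]
    have := mul_le_mul_of_nonneg_left (ee_taylor (t * ((k : ℝ) - μ))) (hq0 k)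
    refine this.trans (le_of_eq ?_)
    rw [abs_mul]; ring
  rw [← c.tsum_eq]
  refine (norm_tsum_le_tsum_norm (Summable.of_nonneg_of_le (fun _ => norm_nonneg _) bd
    d.summable)).trans ?_
  refine (Summable.tsum_le_tsum bd (Summable.of_nonneg_of_le (fun _ => norm_nonneg _) bd
    d.summable) d.summable).trans ?_
  rw [d.tsum_eq]
  apply le_of_eq; ring

lemma asymp (c C D : ℝ) (hc : 0 < c) (hD : 0 < D) :
    ∀ᶠ n : ℕ in atTop, 2 * C * (n : ℝ) * ((n : ℝ) ^ (-(2 / 5) : ℝ)) ^ 4 +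
      2 * Real.pi * Real.exp (-c * n * ((n : ℝ) ^ (-(2 / 5) : ℝ)) ^ 2) ≤ D / Real.sqrt n := by
  have hy : Tendsto (fun n : ℕ => (n : ℝ) ^ (1 / 10 : ℝ)) atTop atTop :=
    (tendsto_rpow_atTop (by norm_num)).comp tendsto_natCast_atTop_atTop
  have h1 : Tendsto (fun y : ℝ => 2 * C * y⁻¹ + 2 * Real.pi * (y ^ 5 * Real.exp (-c * y)))
      atTop (𝓝 (2 * C * 0 + 2 * Real.pi * 0)) := by
    refine (tendsto_inv_atTop_zero.const_mul _).add (Tendsto.const_mul _ ?_)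
    have := Real.tendsto_pow_mul_exp_neg_atTop_nhds_zero 5
    have h := (this.comp (tendsto_id.const_mul_atTop hc)).const_mul (1 / c ^ 5)
    rw [mul_zero] at h
    refine h.congr fun y => ?_
    simp only [Function.comp, id]
    rw [mul_pow]; field_simp
  rw [mul_zero, mul_zero, add_zero] at h1
  have h2 := (h1.comp hy).eventually (gt_mem_nhds hD)
  filter_upwards [h2, eventually_ge_atTop 1] with n hn hn1
  simp only [Function.comp] at hn
  set y := (n : ℝ) ^ (1 / 10 : ℝ) with hydef
  have hn0 : (0 : ℝ) < n := by exact_mod_cast hn1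
  have hy1 : 1 ≤ y := Real.one_le_rpow (by exact_mod_cast hn1) (by norm_num)
  have hy0 : 0 < y := by positivity
  have e1 : (n : ℝ) = y ^ 10 := by
    rw [hydef, ← Real.rpow_natCast, ← Real.rpow_mul hn0.le]; norm_num
  have e2 : Real.sqrt n = y ^ 5 := by
    rw [e1, show y ^ 10 = (y ^ 5) ^ 2 by ring, Real.sqrt_sq (by positivity)]
  have e3 : (n : ℝ) ^ (-(2 / 5) : ℝ) = (y ^ 4)⁻¹ := by
    rw [hydef, ← Real.rpow_natCast, ← Real.rpow_mul hn0.le, ← Real.rpow_neg hn0.le]; norm_num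
  rw [e2, e3, e1, le_div_iff₀ (by positivity)]
  have f1 : -c * y ^ 10 * ((y ^ 4)⁻¹) ^ 2 = -c * y ^ 2 := by field_simp
  have f2 : 2 * C * y ^ 10 * ((y ^ 4)⁻¹) ^ 4 * y ^ 5 = 2 * C * y⁻¹ := by field_simp
  rw [f1, add_mul, f2]
  have f3 : Real.exp (-c * y ^ 2) ≤ Real.exp (-c * y) := by
    apply Real.exp_le_exp.2
    nlinarith [mul_nonneg hc.le (sub_nonneg.2 hy1), mul_nonneg (mul_nonneg hc.le (sub_nonneg.2 hy1)) hy0.le]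
  have f4 : 2 * Real.pi * Real.exp (-c * y ^ 2) * y ^ 5 ≤
      2 * Real.pi * (y ^ 5 * Real.exp (-c * y)) := by
    have := Real.pi_pos
    calc _ = 2 * Real.pi * (y ^ 5 * Real.exp (-c * y ^ 2)) := by ring
      _ ≤ _ := by gcongr
  linarith

/-- Uniform local lower bound. -/
lemma local_lower (c B : ℝ) (hc : 0 < c) (hB : 0 ≤ B) : ∃ d : ℝ, 0 < d ∧ ∀ᶠ n : ℕ in atTop,
    ∀ (q : ℕ → ℝ) (x : ℕ) (μ v w : ℝ), (∀ k, 0 ≤ q k) → HasSum q 1 → (x : ℝ) = n * μ →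
    HasSum (fun k : ℕ => q k * ((k : ℝ) - μ)) 0 →
    HasSum (fun k : ℕ => q k * ((k : ℝ) - μ) ^ 2) v →
    HasSum (fun k : ℕ => q k * |(k : ℝ) - μ| ^ 3) w → v ≤ B → w ≤ B →
    (∀ t : ℝ, |t| ≤ Real.pi → ‖phi q t‖ ≤ Real.exp (-c * t ^ 2)) →
    d / Real.sqrt n ≤ Zweight q n x := by
  have hpi := Real.pi_pos
  set D := Real.exp (-B / 2)
  have hD : 0 < D := Real.exp_pos _
  refine ⟨D / (2 * Real.pi), by positivity, ?_⟩
  filter_upwards [asymp c (4 * B + B ^ 2) D hc hD, eventually_ge_atTop 1] with n hn hn1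
  intro q x μ v w hq0 hq hx h1 h2 h3 hv hw hdec
  set τ := (n : ℝ) ^ (-(2 / 5) : ℝ) with hτ
  have hn0 : (0 : ℝ) < n := by exact_mod_cast hn1
  have hn1' : (1 : ℝ) ≤ n := by exact_mod_cast hn1
  have hτ0 : 0 < τ := Real.rpow_pos_of_pos hn0 _
  have hτ1 : τ ≤ 1 := Real.rpow_le_one_of_one_le_of_nonpos hn1' (by norm_num)
  have hτpi : τ ≤ Real.pi := hτ1.trans (by linarith [Real.pi_gt_three])
  set α := 1 / Real.sqrt n with hα
  have hs0 : 0 < Real.sqrt n := Real.sqrt_pos.2 hn0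
  have hα0 : 0 < α := by positivity
  have hατ : α ≤ τ := by
    rw [hα, hτ, Real.sqrt_eq_rpow, one_div, ← Real.rpow_neg hn0.le]
    exact Real.rpow_le_rpow_of_exponent_le hn1' (by norm_num)
  have hv0 : 0 ≤ v := h2.nonneg fun k => mul_nonneg (hq0 k) (sq_nonneg _)
  have hw0 : 0 ≤ w := h3.nonneg fun k => mul_nonneg (hq0 k) (by positivity)
  let ψ : ℝ → ℂ := fun t => phi q t * ee (-(t * μ))
  have hψc : Continuous ψ := (continuous_phi hq0 hq.summable).mul
    (continuous_ee.comp (by fun_prop))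
  have hψn : ∀ t, ‖ψ t‖ = ‖phi q t‖ := fun t => by simp only [ψ, norm_mul, norm_ee, mul_one]
  have hfour : ∫ t in (-Real.pi)..Real.pi, ψ t ^ n = 2 * Real.pi * (Zweight q n x : ℂ) := by
    rw [← fourier_inv hq0 hq n x]
    congr 1; ext t
    simp only [ψ]
    rw [mul_pow, ← ee_natmul, hx]; congr 2; ring
  let g : ℝ → ℝ := fun t => Real.exp (-(v * t ^ 2 / 2)) ^ n
  have hgc : Continuous g := by fun_prop
  have hψI : ∀ a b, IntervalIntegrable (fun t => ψ t ^ n) MeasureTheory.volume a b :=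
    fun a b => (hψc.pow n).intervalIntegrable a b
  have hsplit : ∫ t in (-Real.pi)..Real.pi, ψ t ^ n =
      (∫ t in (-Real.pi)..(-τ), ψ t ^ n) + (∫ t in (-τ)..τ, ψ t ^ n) +
        ∫ t in τ..Real.pi, ψ t ^ n := by
    rw [intervalIntegral.integral_add_adjacent_intervals (hψI _ _) (hψI _ _),
      intervalIntegral.integral_add_adjacent_intervals (hψI _ _) (hψI _ _)]
  have hout : ∀ t : ℝ, τ ≤ |t| → |t| ≤ Real.pi → ‖ψ t ^ n‖ ≤ Real.exp (-c * n * τ ^ 2) := by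
    intro t ht1 ht2
    rw [norm_pow, hψn]
    calc ‖phi q t‖ ^ n ≤ Real.exp (-c * t ^ 2) ^ n := by
          gcongr; exact hdec t ht2
      _ = Real.exp (n * (-c * t ^ 2)) := (Real.exp_nat_mul _ _).symm
      _ ≤ _ := by
        apply Real.exp_le_exp.2
        have : τ ^ 2 ≤ t ^ 2 := by rw [← sq_abs t]; gcongr
        have := mul_le_mul_of_nonneg_left this (mul_nonneg hc.le hn0.le)
        linarith
  have o1 : ‖∫ t in (-Real.pi)..(-τ), ψ t ^ n‖ ≤ Real.exp (-c * n * τ ^ 2) * Real.pi := by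
    refine (intervalIntegral.norm_integral_le_of_norm_le_const
      (C := Real.exp (-c * n * τ ^ 2)) ?_).trans ?_
    · intro t ht
      rw [Set.uIoc_of_le (by linarith)] at ht
      have : |t| = -t := abs_of_nonpos (by linarith [ht.2])
      exact hout t (by linarith [ht.2]) (by linarith [ht.1])
    · gcongr
      rw [abs_of_nonneg (by linarith)]; linarith
  have o2 : ‖∫ t in τ..Real.pi, ψ t ^ n‖ ≤ Real.exp (-c * n * τ ^ 2) * Real.pi := by
    refine (intervalIntegral.norm_integral_le_of_norm_le_const
      (C := Real.exp (-c * n * τ ^ 2)) ?_).trans ?_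
    · intro t ht
      rw [Set.uIoc_of_le (by linarith)] at ht
      have : |t| = t := abs_of_nonneg (by linarith [ht.1])
      exact hout t (by linarith [ht.1]) (by linarith [ht.2])
    · gcongr
      rw [abs_of_nonneg (by linarith)]; linarith
  have hmid : ∀ t : ℝ, |t| ≤ τ → ‖ψ t ^ n - (g t : ℂ)‖ ≤ (4 * B + B ^ 2) * n * τ ^ 3 := by
    intro t ht
    have s1 := phi_expansion hq0 hq μ v w h1 h2 h3 t
    have hy0 : 0 ≤ v * t ^ 2 / 2 := by positivity
    set y := v * t ^ 2 / 2
    have s2 : |Real.exp (-y) - (1 - y)| ≤ y ^ 2 := by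
      rw [abs_le]
      have l1 := Real.add_one_le_exp (-y)
      have l2 := exp_le_quad (-y) (by linarith)
      constructor <;> nlinarith
    have s3 : ‖ψ t - (Real.exp (-y) : ℂ)‖ ≤ 4 * w * |t| ^ 3 + y ^ 2 := by
      have e : ψ t - (Real.exp (-y) : ℂ) = (phi q t * ee (-(t * μ)) - ((1 - y : ℝ) : ℂ)) -
          ((Real.exp (-y) - (1 - y) : ℝ) : ℂ) := by
        simp only [ψ]; push_cast; ring
      rw [e]
      refine (norm_sub_le _ _).trans (add_le_add s1 ?_)
      rw [Complex.norm_real]; exact s2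
    have s4 : 4 * w * |t| ^ 3 + y ^ 2 ≤ (4 * B + B ^ 2) * τ ^ 3 := by
      have k1 : 4 * w * |t| ^ 3 ≤ 4 * B * τ ^ 3 := by gcongr
      have k2 : y ^ 2 ≤ B ^ 2 * τ ^ 3 := by
        have : y ≤ B * τ ^ 2 := by
          have : v * t ^ 2 ≤ B * τ ^ 2 := by
            rw [← sq_abs t]; gcongr
          have : 0 ≤ v * t ^ 2 := by positivity
          simp only [y]; linarith
        calc y ^ 2 ≤ (B * τ ^ 2) ^ 2 := by gcongr
          _ = B ^ 2 * (τ ^ 3 * τ) := by ring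
          _ ≤ B ^ 2 * (τ ^ 3 * 1) := by gcongr
          _ = _ := by ring
      linarith
    have s5 := norm_pow_sub_pow_le' (ψ t) (Real.exp (-y) : ℂ)
      (by rw [hψn]; exact norm_phi_le_one hq0 hq t)
      (by rw [Complex.norm_real, Real.norm_eq_abs, abs_of_pos (Real.exp_pos _)]
          exact Real.exp_le_one_iff.2 (by linarith)) n
    have e : (g t : ℂ) = (Real.exp (-y) : ℂ) ^ n := by simp only [g, y]; push_cast; rfl
    rw [e]
    refine s5.trans ?_
    calc (n : ℝ) * ‖ψ t - (Real.exp (-y) : ℂ)‖ ≤ n * ((4 * B + B ^ 2) * τ ^ 3) := by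
          gcongr; exact s3.trans s4
      _ = _ := by ring
  have m1 : ‖(∫ t in (-τ)..τ, ψ t ^ n) - ((∫ t in (-τ)..τ, g t : ℝ) : ℂ)‖ ≤
      2 * (4 * B + B ^ 2) * n * τ ^ 4 := by
    have hgI : IntervalIntegrable (fun t => (g t : ℂ)) MeasureTheory.volume (-τ) τ :=
      (Complex.continuous_ofReal.comp hgc).intervalIntegrable _ _
    rw [← intervalIntegral.integral_ofReal, ← intervalIntegral.integral_sub (hψI _ _) hgI]
    refine (intervalIntegral.norm_integral_le_of_norm_le_const
      (C := (4 * B + B ^ 2) * n * τ ^ 3) ?_).trans ?_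
    · intro t ht
      rw [Set.uIoc_of_le (by linarith)] at ht
      exact hmid t (abs_le.2 ⟨ht.1.le, ht.2⟩)
    · rw [abs_of_nonneg (by linarith)]
      apply le_of_eq; ring
  have m2 : 2 * D * α ≤ ∫ t in (-τ)..τ, g t := by
    have i1 : ∫ t in (-α)..α, g t ≤ ∫ t in (-τ)..τ, g t := by
      apply intervalIntegral.integral_mono_interval (by linarith) (by linarith) hατ
      · exact Eventually.of_forall fun t => by simp only [g]; positivity
      · exact hgc.intervalIntegrable _ _
    have i2 : ∫ t in (-α)..α, D ≤ ∫ t in (-α)..α, g t := by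
      apply intervalIntegral.integral_mono_on (by linarith)
        (continuous_const.intervalIntegrable _ _) (hgc.intervalIntegrable _ _)
      intro t ht
      simp only [g, D]
      rw [← Real.exp_nat_mul]
      apply Real.exp_le_exp.2
      have : t ^ 2 ≤ α ^ 2 := sq_le_sq' ht.1 ht.2
      have h5 : α ^ 2 = 1 / n := by rw [hα, div_pow, Real.sq_sqrt hn0.le]; simp
      rw [h5] at this
      have h6 : n * t ^ 2 ≤ 1 := by
        rw [le_div_iff₀ hn0] at this; linarith
      have h7 : v * (n * t ^ 2) ≤ B * 1 := by gcongr
      linarith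
    rw [intervalIntegral.integral_const, smul_eq_mul] at i2
    linarith
  set I1 := ∫ t in (-Real.pi)..(-τ), ψ t ^ n
  set I2 := ∫ t in (-τ)..τ, ψ t ^ n
  set I3 := ∫ t in τ..Real.pi, ψ t ^ n
  have hre : 2 * Real.pi * Zweight q n x = I1.re + I2.re + I3.re := by
    have := congrArg Complex.re (hfour.symm.trans hsplit)
    simpa using this
  have r1 := (abs_le.1 ((Complex.abs_re_le_norm I1).trans o1)).1
  have r3 := (abs_le.1 ((Complex.abs_re_le_norm I3).trans o2)).1
  have r2 := (abs_le.1 ((Complex.abs_re_le_norm _).trans m1)).1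
  rw [Complex.sub_re, Complex.ofReal_re] at r2
  have hfin : D * α ≤ 2 * Real.pi * Zweight q n x := by
    have hn' : 2 * (4 * B + B ^ 2) * n * τ ^ 4 +
      2 * Real.pi * Real.exp (-c * n * τ ^ 2) ≤ D * α := by
      rw [hα, mul_one_div]; exact hn
    rw [hre]
    linarith
  rw [div_div, div_le_iff₀ (by positivity)]
  rw [hα, mul_one_div, div_le_iff₀ hs0] at hfin
  linarith

lemma chernoff {q : ℕ → ℝ} (hq0 : ∀ k, 0 ≤ q k) (hq : HasSum q 1) (h : ℕ → ℝ) (V l ε : ℝ)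
    (hl : 0 ≤ l) (h1 : HasSum (fun k => q k * h k) 0) (h2 : HasSum (fun k => q k * h k ^ 2) V)
    (A : Finset ℕ) (hA : ∀ k ∈ A, l * h k ≤ 1) (n : ℕ) (T : Finset (Fin n → ℕ))
    (hT : ∀ f ∈ T, (∀ i, f i ∈ A) ∧ n * ε ≤ ∑ i, h (f i)) :
    ∑ f ∈ T, ∏ i, q (f i) ≤ Real.exp (n * (l ^ 2 * V - l * ε)) := by
  have a1 : ∑ f ∈ T, ∏ i, q (f i) ≤
      ∑ f ∈ T, Real.exp (-(l * (n * ε))) * ∏ i, (q (f i) * Real.exp (l * h (f i))) := by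
    refine Finset.sum_le_sum fun f hf => ?_
    rw [Finset.prod_mul_distrib, ← Real.exp_sum, ← Finset.mul_sum, mul_left_comm, ← Real.exp_add]
    have : 1 ≤ Real.exp (-(l * (n * ε)) + l * ∑ i, h (f i)) := by
      apply Real.one_le_exp
      have := mul_le_mul_of_nonneg_left (hT f hf).2 hl
      linarith
    exact le_mul_of_one_le_right (Finset.prod_nonneg fun i _ => hq0 _) this
  have a2 : ∑ f ∈ T, ∏ i, (q (f i) * Real.exp (l * h (f i))) ≤
      (∑ k ∈ A, q k * Real.exp (l * h k)) ^ n := by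
    have := Finset.prod_univ_sum (fun _ : Fin n => A) (fun _ k => q k * Real.exp (l * h k))
    rw [Finset.prod_const, Finset.card_univ, Fintype.card_fin] at this
    rw [this]
    apply Finset.sum_le_sum_of_subset_of_nonneg
    · intro f hf
      exact Fintype.mem_piFinset.2 (hT f hf).1
    · intro f _ _
      exact Finset.prod_nonneg fun i _ => mul_nonneg (hq0 _) (Real.exp_pos _).le
  have a3 : ∑ k ∈ A, q k * Real.exp (l * h k) ≤ Real.exp (l ^ 2 * V) := by
    have s := (hq.add (h1.mul_left l)).add (h2.mul_left (l ^ 2))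
    calc ∑ k ∈ A, q k * Real.exp (l * h k)
        ≤ ∑ k ∈ A, (q k + l * (q k * h k) + l ^ 2 * (q k * h k ^ 2)) := by
          refine Finset.sum_le_sum fun k hk => ?_
          have := mul_le_mul_of_nonneg_left (exp_le_quad _ (hA k hk)) (hq0 k)
          linarith
      _ ≤ 1 + l * 0 + l ^ 2 * V := by
          refine sum_le_hasSum _ (fun k _ => ?_) s
          have : 0 ≤ q k * (1 + l * h k + (l * h k) ^ 2) :=
            mul_nonneg (hq0 k) (by nlinarith [sq_nonneg (l * h k + 1 / 2)])
          linarith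
      _ ≤ _ := by
          have := Real.add_one_le_exp (l ^ 2 * V)
          linarith
  rw [← Finset.mul_sum] at a1
  refine a1.trans ?_
  have a4 : (∑ k ∈ A, q k * Real.exp (l * h k)) ^ n ≤ Real.exp (l ^ 2 * V) ^ n :=
    pow_le_pow_left₀ (Finset.sum_nonneg fun k _ => mul_nonneg (hq0 _) (Real.exp_pos _).le) a3 n
  rw [← Real.exp_nat_mul] at a4
  calc _ ≤ Real.exp (-(l * (n * ε))) * Real.exp (n * (l ^ 2 * V)) := by
        gcongr; exact a2.trans a4
    _ = _ := by rw [← Real.exp_add]; congr 1; ring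

lemma tail_union {q : ℕ → ℝ} (hq0 : ∀ k, 0 ≤ q k) (hq : HasSum q 1) (W : ℝ)
    (h8 : HasSum (fun k : ℕ => q k * (k : ℝ) ^ 8) W) (n : ℕ) (hn : 1 ≤ n) (N : ℕ)
    (T : Finset (Fin n → ℕ)) (hT : ∀ f ∈ T, (∀ i, f i < N) ∧ ∃ i, (n : ℝ) < (f i : ℝ) ^ 4) :
    ∑ f ∈ T, ∏ i, q (f i) ≤ W / n := by
  have hn0 : (0 : ℝ) < n := by exact_mod_cast hn
  have hsub : T ⊆ Fintype.piFinset (fun _ : Fin n => Finset.range N) := fun f hf =>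
    Fintype.mem_piFinset.2 fun i => Finset.mem_range.2 ((hT f hf).1 i)
  have hW : 0 ≤ W := h8.nonneg fun k => mul_nonneg (hq0 k) (by positivity)
  have a1 : ∑ f ∈ T, ∏ i, q (f i) ≤
      ∑ f ∈ T, ∑ i, (∏ j, q (f j)) * (f i : ℝ) ^ 8 / n ^ 2 := by
    refine Finset.sum_le_sum fun f hf => ?_
    obtain ⟨i, hi⟩ := (hT f hf).2
    have hp : 0 ≤ ∏ j, q (f j) := Finset.prod_nonneg fun i _ => hq0 _
    have b : (∏ j, q (f j)) * (f i : ℝ) ^ 8 / n ^ 2 ≤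
        ∑ i, (∏ j, q (f j)) * (f i : ℝ) ^ 8 / n ^ 2 :=
      Finset.single_le_sum (f := fun i => (∏ j, q (f j)) * (f i : ℝ) ^ 8 / n ^ 2)
        (fun i _ => by positivity) (Finset.mem_univ i)
    refine le_trans ?_ b
    rw [le_div_iff₀ (by positivity)]
    have : (n : ℝ) ^ 2 ≤ (f i : ℝ) ^ 8 := by
      calc (n : ℝ) ^ 2 ≤ ((f i : ℝ) ^ 4) ^ 2 := by gcongr
        _ = _ := by ring
    gcongr
  have a2 : ∀ i : Fin n, ∑ f ∈ T, (∏ j, q (f j)) * (f i : ℝ) ^ 8 / n ^ 2 ≤ W / n ^ 2 := by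
    intro i
    rw [← Finset.sum_div]
    gcongr
    have e := Finset.prod_univ_sum (fun _ : Fin n => Finset.range N)
      (fun j k => q k * (if j = i then (k : ℝ) ^ 8 else 1))
    have e2 : ∀ f : Fin n → ℕ, ∏ j, (q (f j) * (if j = i then (f j : ℝ) ^ 8 else 1)) =
        (∏ j, q (f j)) * (f i : ℝ) ^ 8 := by
      intro f
      rw [Finset.prod_mul_distrib, Finset.prod_ite_eq']
      simp
    simp_rw [e2] at e
    calc ∑ f ∈ T, (∏ j, q (f j)) * (f i : ℝ) ^ 8
        ≤ ∑ f ∈ Fintype.piFinset (fun _ : Fin n => Finset.range N),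
            (∏ j, q (f j)) * (f i : ℝ) ^ 8 :=
          Finset.sum_le_sum_of_subset_of_nonneg hsub fun f _ _ =>
            mul_nonneg (Finset.prod_nonneg fun i _ => hq0 _) (by positivity)
      _ = _ := e.symm
      _ ≤ ∏ j : Fin n, (if j = i then W else 1) := by
          refine Finset.prod_le_prod (fun j _ => Finset.sum_nonneg fun k _ =>
            mul_nonneg (hq0 _) (by split_ifs <;> positivity)) fun j _ => ?_
          by_cases hj : j = i
          · simp only [hj, if_true]
            exact sum_le_hasSum _ (fun k _ => mul_nonneg (hq0 k) (by positivity)) h8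
          · simp only [hj, if_false, mul_one]
            exact sum_le_hasSum _ (fun k _ => hq0 k) hq
      _ = W := by rw [Finset.prod_ite_eq']; simp
  refine a1.trans ?_
  rw [Finset.sum_comm]
  refine (Finset.sum_le_sum fun i _ => a2 i).trans (le_of_eq ?_)
  rw [Finset.sum_const, Finset.card_univ, Fintype.card_fin, nsmul_eq_mul]
  field_simp

lemma numerator_le {q : ℕ → ℝ} (hq0 : ∀ k, 0 ≤ q k) (hq : HasSum q 1) (m V W ε : ℝ)
    (h1 : HasSum (fun k : ℕ => q k * ((k : ℝ) ^ 2 - m)) 0)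
    (h2 : HasSum (fun k : ℕ => q k * ((k : ℝ) ^ 2 - m) ^ 2) V)
    (h8 : HasSum (fun k : ℕ => q k * (k : ℝ) ^ 8) W) (n x : ℕ) (hn : 1 ≤ n)
    (hm0 : 0 ≤ m) (hm : m ≤ Real.sqrt n) :
    ∑ f ∈ (Finset.Nat.antidiagonalTuple n x).filter
      (fun f => ε ≤ |(∑ i, (f i : ℝ) ^ 2) / n - m|), ∏ i, q (f i) ≤
      2 * Real.exp (V - ε * Real.sqrt n) + W / n := by
  have hn0 : (0 : ℝ) < n := by exact_mod_cast hn
  have hs0 : 0 < Real.sqrt n := Real.sqrt_pos.2 hn0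
  have hss : Real.sqrt n ^ 2 = n := Real.sq_sqrt hn0.le
  set T := Finset.Nat.antidiagonalTuple n x
  have hTx : ∀ f ∈ T, ∀ i, f i < x + 1 := by
    intro f hf i
    have := Finset.Nat.mem_antidiagonalTuple.1 hf
    have := Finset.single_le_sum (f := f) (fun i _ => Nat.zero_le _) (Finset.mem_univ i)
    omega
  set l := 1 / Real.sqrt n with hl
  have hl0 : 0 < l := by positivity
  have hexp : n * (l ^ 2 * V - l * ε) = V - ε * Real.sqrt n := by
    rw [hl]
    rw [← hss, Real.sqrt_sq hs0.le]; field_simp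
  let A : Finset (Fin n → ℕ) := T.filter fun f => n * ε ≤ ∑ i, (m - (f i : ℝ) ^ 2)
  let B : Finset (Fin n → ℕ) := T.filter fun f => (∀ i, (f i : ℝ) ^ 4 ≤ n) ∧
    n * ε ≤ ∑ i, ((f i : ℝ) ^ 2 - m)
  let C : Finset (Fin n → ℕ) := T.filter fun f => ∃ i, (n : ℝ) < (f i : ℝ) ^ 4
  have hA : ∑ f ∈ A, ∏ i, q (f i) ≤ Real.exp (V - ε * Real.sqrt n) := by
    rw [← hexp]
    refine chernoff hq0 hq (fun k => m - (k : ℝ) ^ 2) V l ε hl0.le ?_ ?_ (Finset.range (x + 1))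
      ?_ n A ?_
    · have h1' := h1.neg
      rw [neg_zero] at h1'
      refine h1'.congr_fun fun k => ?_
      ring
    · convert h2 using 1
      ext k; ring
    · intro k _
      rw [hl, one_div_mul_eq_div, div_le_one hs0]
      nlinarith [sq_nonneg (k : ℝ)]
    · intro f hf
      have hf := Finset.mem_filter.1 hf
      exact ⟨fun i => Finset.mem_range.2 (hTx f hf.1 i), hf.2⟩
  have hB : ∑ f ∈ B, ∏ i, q (f i) ≤ Real.exp (V - ε * Real.sqrt n) := by
    rw [← hexp]
    refine chernoff hq0 hq (fun k => (k : ℝ) ^ 2 - m) V l ε hl0.le h1 h2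
      ((Finset.range (x + 1)).filter fun k => (k : ℝ) ^ 4 ≤ n) ?_ n B ?_
    · intro k hk
      have hk := (Finset.mem_filter.1 hk).2
      rw [hl, one_div_mul_eq_div, div_le_one hs0]
      have : (k : ℝ) ^ 2 ≤ Real.sqrt n := by
        apply Real.le_sqrt_of_sq_le
        rw [← pow_mul]; exact hk
      linarith
    · intro f hf
      have hf := Finset.mem_filter.1 hf
      exact ⟨fun i => Finset.mem_filter.2 ⟨Finset.mem_range.2 (hTx f hf.1 i), hf.2.1 i⟩, hf.2.2⟩
  have hC : ∑ f ∈ C, ∏ i, q (f i) ≤ W / n := by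
    refine tail_union hq0 hq W h8 n hn (x + 1) C fun f hf => ?_
    have hf := Finset.mem_filter.1 hf
    exact ⟨hTx f hf.1, hf.2⟩
  have hnn : ∀ f : Fin n → ℕ, 0 ≤ ∏ i, q (f i) := fun f => Finset.prod_nonneg fun i _ => hq0 _
  have hun : ∀ s t : Finset (Fin n → ℕ), ∑ f ∈ s ∪ t, ∏ i, q (f i) ≤
      ∑ f ∈ s, ∏ i, q (f i) + ∑ f ∈ t, ∏ i, q (f i) := by
    intro s t
    rw [← Finset.sum_union_inter]
    exact le_add_of_nonneg_right (Finset.sum_nonneg fun f _ => hnn f)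
  have hsub : T.filter (fun f => ε ≤ |(∑ i, (f i : ℝ) ^ 2) / n - m|) ⊆ (A ∪ B) ∪ C := by
    intro f hf
    obtain ⟨hfT, hf⟩ := Finset.mem_filter.1 hf
    simp only [Finset.mem_union, A, B, C, Finset.mem_filter, hfT, true_and]
    by_cases hc : ∃ i, (n : ℝ) < (f i : ℝ) ^ 4
    · exact Or.inr hc
    · left
      push Not at hc
      have e : (∑ i, (f i : ℝ) ^ 2) = n * ((∑ i, (f i : ℝ) ^ 2) / n) := by field_simp
      rcases le_abs.1 hf with h | h
      · right
        refine ⟨hc, ?_⟩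
        rw [Finset.sum_sub_distrib, e]
        simp only [Finset.sum_const, Finset.card_univ, Fintype.card_fin, nsmul_eq_mul]
        rw [← mul_sub]; gcongr
      · left
        rw [Finset.sum_sub_distrib, e]
        simp only [Finset.sum_const, Finset.card_univ, Fintype.card_fin, nsmul_eq_mul]
        rw [← mul_sub]; gcongr; linarith
  refine (Finset.sum_le_sum_of_subset_of_nonneg hsub fun f _ _ => hnn f).trans ?_
  have := hun (A ∪ B) C
  have := hun A B
  linarith

/-- `momF p j s = ∑ p k k^j s^k`. -/
noncomputable def momF (p : ℕ → ℝ) (j : ℕ) (s : ℝ) : ℝ := ∑' k : ℕ, p k * (k : ℝ) ^ j * s ^ k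

lemma summable_mom {p : ℕ → ℝ} (hp : ∀ k, 0 ≤ p k) {ρ : ℝ}
    (hconv : ∀ s : ℝ, 0 ≤ s → s < ρ → Summable (fun k : ℕ => p k * s ^ k)) (j : ℕ) (s : ℝ)
    (hs0 : 0 ≤ s) (hs : s < ρ) : Summable (fun k : ℕ => p k * (k : ℝ) ^ j * s ^ k) := by
  obtain ⟨r, hsr, hr⟩ := exists_between hs
  have hr0 : 0 < r := lt_of_le_of_lt hs0 hsr
  have h1 : ‖s / r‖ < 1 := by
    rw [Real.norm_eq_abs, abs_of_nonneg (by positivity), div_lt_one hr0]; exact hsr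
  have h2 := (summable_pow_mul_geometric_of_norm_lt_one j h1).tendsto_atTop_zero
  obtain ⟨C, hC⟩ := h2.bddAbove_range
  refine Summable.of_nonneg_of_le (fun k => ?_) (fun k => ?_) ((hconv r hr0.le hr).mul_left C)
  · have := hp k; positivity
  · have h3 : (k : ℝ) ^ j * (s / r) ^ k ≤ C := hC ⟨k, rfl⟩
    have h4 : s ^ k = (s / r) ^ k * r ^ k := by rw [← mul_pow, div_mul_cancel₀ _ hr0.ne']
    calc p k * (k : ℝ) ^ j * s ^ k = ((k : ℝ) ^ j * (s / r) ^ k) * (p k * r ^ k) := by rw [h4]; ring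
      _ ≤ C * (p k * r ^ k) := by
        have := hp k
        gcongr

lemma hasDerivAt_momF {p : ℕ → ℝ} (hp : ∀ k, 0 ≤ p k) {ρ : ℝ}
    (hconv : ∀ s : ℝ, 0 ≤ s → s < ρ → Summable (fun k : ℕ => p k * s ^ k)) (j : ℕ) (s : ℝ)
    (hs0 : 0 < s) (hs : s < ρ) : HasDerivAt (momF p j) (momF p (j + 1) s / s) s := by
  obtain ⟨r, hsr, hr⟩ := exists_between hs
  have hr0 : 0 < r := lt_trans hs0 hsr
  have key : ∀ (k : ℕ) (y : ℝ), 0 < y → p k * (k : ℝ) ^ j * (k * y ^ (k - 1)) =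
      p k * (k : ℝ) ^ (j + 1) * y ^ k / y := by
    intro k y hy
    cases k with
    | zero => simp
    | succ k => field_simp; simp; ring
  have h := hasDerivAt_tsum_of_isPreconnected
    (g := fun (k : ℕ) (z : ℝ) => p k * (k : ℝ) ^ j * z ^ k)
    (g' := fun (k : ℕ) (z : ℝ) => p k * (k : ℝ) ^ j * (k * z ^ (k - 1)))
    (u := fun k : ℕ => p k * (k : ℝ) ^ (j + 1) * r ^ k / r) (t := Set.Ioo 0 r)
    (y₀ := s) (y := s) ((summable_mom hp hconv (j + 1) r hr0.le hr).div_const r)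
    isOpen_Ioo isPreconnected_Ioo
    (fun k y _ => (hasDerivAt_pow k y).const_mul _) ?_ ⟨hs0, hsr⟩
    (summable_mom hp hconv j s hs0.le hs) ⟨hs0, hsr⟩
  · have e : momF p (j + 1) s / s = ∑' k : ℕ, p k * (k : ℝ) ^ j * (k * s ^ (k - 1)) := by
      unfold momF
      rw [← tsum_div_const]
      exact tsum_congr fun k => (key k s hs0).symm
    rw [e]; exact h
  · intro k y hy
    have hpk := hp k
    rw [← key k r hr0, Real.norm_eq_abs, abs_of_nonneg]
    · have := hy.1.le
      have := hy.2.le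
      gcongr
    · have := hy.1.le
      positivity

/-- Normalised moments of the tilted law. -/
noncomputable def momR (p : ℕ → ℝ) (j : ℕ) (s : ℝ) : ℝ := momF p j s / momF p 0 s

/-- The tilted law. -/
noncomputable def tilt (p : ℕ → ℝ) (s : ℝ) (k : ℕ) : ℝ := p k * s ^ k / momF p 0 s

lemma bridgeProb_tilt (p : ℕ → ℝ) (s : ℝ) (hs : 0 < s) (ha : 0 < momF p 0 s) (n x : ℕ)
    (E : (Fin n → ℕ) → Prop) : bridgeProb p n x E = bridgeProb (tilt p s) n x E := by
  have h : ∀ f ∈ Finset.Nat.antidiagonalTuple n x, ∏ i, tilt p s (f i) =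
      (∏ i, p (f i)) * (s ^ x / momF p 0 s ^ n) := by
    intro f hf
    have hf := Finset.Nat.mem_antidiagonalTuple.1 hf
    unfold tilt
    rw [Finset.prod_div_distrib, Finset.prod_mul_distrib, Finset.prod_pow_eq_pow_sum, hf,
      Finset.prod_const, Finset.card_univ, Fintype.card_fin, mul_div_assoc]
  unfold bridgeProb Zweight
  rw [Finset.sum_congr rfl h, Finset.sum_congr rfl (fun f hf => h f (Finset.mem_filter.1 hf).1),
    ← Finset.sum_mul, ← Finset.sum_mul, mul_div_mul_right]
  positivity

lemma momF_zero_pos {p : ℕ → ℝ} (hp : ∀ k, 0 ≤ p k) {ρ : ℝ}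
    (hconv : ∀ s : ℝ, 0 ≤ s → s < ρ → Summable (fun k : ℕ => p k * s ^ k))
    (hex : ∃ k, 0 < p k) (s : ℝ) (hs0 : 0 < s) (hs : s < ρ) : 0 < momF p 0 s := by
  obtain ⟨k, hk⟩ := hex
  refine (summable_mom hp hconv 0 s hs0.le hs).tsum_pos (fun k => ?_) k ?_
  · have := hp k; positivity
  · positivity

lemma tilt_hasSum {p : ℕ → ℝ} (hp : ∀ k, 0 ≤ p k) {ρ : ℝ}
    (hconv : ∀ s : ℝ, 0 ≤ s → s < ρ → Summable (fun k : ℕ => p k * s ^ k))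
    (j : ℕ) (s : ℝ) (hs0 : 0 < s) (hs : s < ρ) :
    HasSum (fun k : ℕ => tilt p s k * (k : ℝ) ^ j) (momR p j s) := by
  have := (summable_mom hp hconv j s hs0.le hs).hasSum.div_const (momF p 0 s)
  refine this.congr_fun fun k => ?_
  unfold tilt; ring

lemma momR_map_nhds {p : ℕ → ℝ} (hp : ∀ k, 0 ≤ p k) {ρ : ℝ}
    (hconv : ∀ s : ℝ, 0 ≤ s → s < ρ → Summable (fun k : ℕ => p k * s ^ k))
    (hap : ¬ ∃ (a h : ℤ), 2 ≤ h ∧ ∀ k : ℕ, 0 < p k → h ∣ ((k : ℤ) - a))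
    (hex : ∃ k, 0 < p k) (b : ℝ) (hb0 : 0 < b) (hb : b < ρ) :
    map (momR p 1) (𝓝 b) = 𝓝 (momR p 1 b) := by
  have hcont : ∀ j, ContinuousAt (momF p j) b := fun j =>
    (hasDerivAt_momF hp hconv j b hb0 hb).continuousAt
  have hpos := momF_zero_pos hp hconv hex b hb0 hb
  have hd : HasStrictDerivAt (momR p 1) (((momF p 2 b / b) * momF p 0 b -
      momF p 1 b * (momF p 1 b / b)) / momF p 0 b ^ 2) b := by
    apply hasStrictDerivAt_of_hasDerivAt_of_continuousAt
      (f' := fun y => ((momF p 2 y / y) * momF p 0 y -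
      momF p 1 y * (momF p 1 y / y)) / momF p 0 y ^ 2)
    · filter_upwards [Ioo_mem_nhds hb0 hb] with y hy
      exact (hasDerivAt_momF hp hconv 1 y hy.1 hy.2).div (hasDerivAt_momF hp hconv 0 y hy.1 hy.2)
        (momF_zero_pos hp hconv hex y hy.1 hy.2).ne'
    · have h0 := hcont 0
      have h1 := hcont 1
      have h2 := hcont 2
      refine ContinuousAt.div ?_ (h0.pow 2) (by positivity)
      exact ((h2.div continuousAt_id hb0.ne').mul h0).sub
        (h1.mul (h1.div continuousAt_id hb0.ne'))
  refine hd.map_nhds_eq (ne_of_gt ?_)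
  -- strict positivity of the variance
  have hvar : 0 < momF p 2 b * momF p 0 b - momF p 1 b ^ 2 := by
    set μ := momR p 1 b with hμ
    have s0 := (summable_mom hp hconv 0 b hb0.le hb).hasSum
    have s1 := (summable_mom hp hconv 1 b hb0.le hb).hasSum
    have s2 := (summable_mom hp hconv 2 b hb0.le hb).hasSum
    have s := (s2.sub (s1.mul_left (2 * μ))).add (s0.mul_left (μ ^ 2))
    have s' : HasSum (fun k : ℕ => p k * b ^ k * ((k : ℝ) - μ) ^ 2)
        (momF p 2 b - 2 * μ * momF p 1 b + μ ^ 2 * momF p 0 b) := by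
      refine s.congr_fun fun k => ?_
      ring
    obtain ⟨k, hk, hkμ⟩ : ∃ k : ℕ, 0 < p k ∧ (k : ℝ) ≠ μ := by
      by_contra hcon
      push Not at hcon
      obtain ⟨k₀, hk₀⟩ := hex
      refine hap ⟨k₀, 2, le_rfl, fun k hk => ?_⟩
      have : (k : ℝ) = k₀ := (hcon k hk).trans (hcon k₀ hk₀).symm
      have : k = k₀ := by exact_mod_cast this
      simp [this]
    have hp' : 0 < momF p 2 b - 2 * μ * momF p 1 b + μ ^ 2 * momF p 0 b := by
      rw [← s'.tsum_eq]
      refine s'.summable.tsum_pos (fun k => ?_) k ?_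
      · have := hp k; positivity
      · have := sub_ne_zero.2 hkμ
        positivity
    have e : momF p 2 b * momF p 0 b - momF p 1 b ^ 2 =
        (momF p 2 b - 2 * μ * momF p 1 b + μ ^ 2 * momF p 0 b) * momF p 0 b := by
      rw [hμ]; unfold momR; field_simp; ring
    rw [e]; positivity
  have e : (momF p 2 b / b * momF p 0 b - momF p 1 b * (momF p 1 b / b)) / momF p 0 b ^ 2 =
      (momF p 2 b * momF p 0 b - momF p 1 b ^ 2) / (b * momF p 0 b ^ 2) := by
    field_simp
  rw [e]; positivity

lemma genFun_eq (p : ℕ → ℝ) : genFun p = momF p 0 := by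
  ext s; unfold genFun momF; simp

lemma deriv_genFun {p : ℕ → ℝ} (hp : ∀ k, 0 ≤ p k) {ρ : ℝ}
    (hconv : ∀ s : ℝ, 0 ≤ s → s < ρ → Summable (fun k : ℕ => p k * s ^ k))
    (s : ℝ) (hs0 : 0 < s) (hs : s < ρ) : deriv (genFun p) s = momF p 1 s / s := by
  rw [genFun_eq]; exact (hasDerivAt_momF hp hconv 0 s hs0 hs).deriv

lemma deriv2_genFun {p : ℕ → ℝ} (hp : ∀ k, 0 ≤ p k) {ρ : ℝ}
    (hconv : ∀ s : ℝ, 0 ≤ s → s < ρ → Summable (fun k : ℕ => p k * s ^ k))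
    (s : ℝ) (hs0 : 0 < s) (hs : s < ρ) :
    iteratedDeriv 2 (genFun p) s = (momF p 2 s / s * s - momF p 1 s * 1) / s ^ 2 := by
  rw [iteratedDeriv_succ, iteratedDeriv_one]
  have : deriv (genFun p) =ᶠ[𝓝 s] fun y => momF p 1 y / y := by
    filter_upwards [Ioo_mem_nhds hs0 hs] with y hy
    exact deriv_genFun hp hconv y hy.1 hy.2
  rw [this.deriv_eq]
  exact ((hasDerivAt_momF hp hconv 1 s hs0 hs).div (hasDerivAt_id s) hs0.ne').deriv

lemma final_asymp (K d ε : ℝ) (hε : 0 < ε) :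
    Tendsto (fun n : ℕ => (2 * Real.exp (K - ε * Real.sqrt n) + K / n) / (d / Real.sqrt n))
      atTop (𝓝 0) := by
  have hy : Tendsto (fun n : ℕ => Real.sqrt n) atTop atTop :=
    Real.tendsto_sqrt_atTop.comp tendsto_natCast_atTop_atTop
  have h1 : Tendsto (fun y : ℝ => (2 * Real.exp K / d) * (y * Real.exp (-ε * y)) + K / d * y⁻¹)
      atTop (𝓝 ((2 * Real.exp K / d) * 0 + K / d * 0)) := by
    refine (Tendsto.const_mul _ ?_).add (tendsto_inv_atTop_zero.const_mul _)
    have := Real.tendsto_pow_mul_exp_neg_atTop_nhds_zero 1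
    have h := (this.comp (tendsto_id.const_mul_atTop hε)).const_mul (1 / ε)
    rw [mul_zero] at h
    refine h.congr fun y => ?_
    simp only [Function.comp, id]
    rw [pow_one]; field_simp
  rw [mul_zero, mul_zero, add_zero] at h1
  refine (h1.comp hy).congr' ?_
  filter_upwards [eventually_ge_atTop 1] with n hn
  simp only [Function.comp]
  have hn0 : (0 : ℝ) < n := by exact_mod_cast hn
  have hs0 : 0 < Real.sqrt n := Real.sqrt_pos.2 hn0
  have e : (n : ℝ) = Real.sqrt n ^ 2 := (Real.sq_sqrt hn0.le).symm
  rw [show K / (n : ℝ) = K / Real.sqrt n ^ 2 by rw [← e]]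
  rw [sub_eq_add_neg, Real.exp_add, neg_mul]
  set y := Real.sqrt n
  rw [div_div_eq_mul_div]
  field_simp

/-- **Law of large numbers for squared increments in the bulk regime** (Proposition A.1):
under `P^{p,n}_{x_n}` with `x_n/n → γ = Ψ(b)`, `(1/n)∑ (X^n_k)² → (b²G''(b)+bG'(b))/G(b)`
in probability. -/
theorem squares_lln_bulk
    (p : ℕ → ℝ) (hp_nonneg : ∀ k, 0 ≤ p k)
    (hp_aperiodic : ¬ ∃ (a h : ℤ), 2 ≤ h ∧ ∀ k : ℕ, 0 < p k → h ∣ ((k : ℤ) - a))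
    (ρ : ℝ) (hρ : 0 < ρ)
    (hρ_conv : ∀ s : ℝ, 0 ≤ s → s < ρ → Summable (fun k : ℕ => p k * s ^ k))
    (hρ_div : ∀ s : ℝ, ρ < s → ¬ Summable (fun k : ℕ => p k * s ^ k))
    (x : ℕ → ℕ) (hZ : ∀ n, 0 < Zweight p n (x n))
    (γ : ℝ) (hγ : Tendsto (fun n : ℕ => (x n : ℝ) / n) atTop (𝓝 γ))
    (hγ_low : ((sInf {k : ℕ | 0 < p k} : ℕ) : ℝ) < γ)
    (b : ℝ) (hb_mem : b ∈ Set.Ioo (0 : ℝ) ρ) (hb : PsiFun p b = γ) :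
    ∀ ε > 0, Tendsto (fun n : ℕ =>
      bridgeProb p n (x n) (fun f => ε ≤
        |(∑ i, (f i : ℝ) ^ 2) / n -
          (b ^ 2 * iteratedDeriv 2 (genFun p) b + b * deriv (genFun p) b) / genFun p b|))
      atTop (𝓝 0) := by
  intro ε hε
  obtain ⟨hb0, hbρ⟩ := hb_mem
  obtain ⟨C, F, hC, hF, hCF⟩ := aperiodic_bound p hp_aperiodic
  have hex : ∃ k, 0 < p k := by
    obtain ⟨z, hz, _⟩ := hCF 0
    exact ⟨z.1, (hF z hz).1⟩
  have hpos : ∀ s, 0 < s → s < ρ → 0 < momF p 0 s := fun s h0 h1 =>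
    momF_zero_pos hp_nonneg hρ_conv hex s h0 h1
  have hcF : ∀ j, ContinuousAt (momF p j) b := fun j =>
    (hasDerivAt_momF hp_nonneg hρ_conv j b hb0 hbρ).continuousAt
  have hcR : ∀ j, ContinuousAt (momR p j) b := fun j =>
    (hcF j).div (hcF 0) (hpos b hb0 hbρ).ne'
  have hm : (b ^ 2 * iteratedDeriv 2 (genFun p) b + b * deriv (genFun p) b) / genFun p b =
      momR p 2 b := by
    rw [deriv2_genFun hp_nonneg hρ_conv b hb0 hbρ, deriv_genFun hp_nonneg hρ_conv b hb0 hbρ,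
      genFun_eq]
    unfold momR
    congr 1
    field_simp
    ring
  have hγb : γ = momR p 1 b := by
    rw [← hb]
    unfold PsiFun momR
    rw [deriv_genFun hp_nonneg hρ_conv b hb0 hbρ, genFun_eq]
    field_simp
  rw [hm]
  -- constants
  have hRnn : ∀ j s, 0 < s → s < ρ → 0 ≤ momR p j s := fun j s h0 h1 =>
    (tilt_hasSum hp_nonneg hρ_conv j s h0 h1).nonneg fun k => by
      have := hpos s h0 h1
      have := hp_nonneg k
      unfold tilt; positivity
  obtain ⟨K, hK1, hK⟩ : ∃ K : ℝ, 1 ≤ K ∧ ∀ᶠ s in 𝓝 b, ∀ j ∈ Finset.range 9, momR p j s ≤ K := by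
    refine ⟨∑ j ∈ Finset.range 9, momR p j b + 1, ?_, ?_⟩
    · have := Finset.sum_nonneg (s := Finset.range 9) fun j _ => hRnn j b hb0 hbρ
      linarith
    · rw [Filter.eventually_all_finset]
      intro j hj
      have h1 : momR p j b < ∑ j ∈ Finset.range 9, momR p j b + 1 := by
        have := Finset.single_le_sum (f := fun j => momR p j b)
          (fun j _ => hRnn j b hb0 hbρ) hj
        linarith
      exact ((hcR j).eventually (gt_mem_nhds h1)).mono fun s hs => hs.le
  obtain ⟨δ, hδ, hδF⟩ : ∃ δ : ℝ, 0 < δ ∧ ∀ᶠ s in 𝓝 b, ∀ z ∈ F,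
      δ ≤ tilt p s z.1 ∧ δ ≤ tilt p s z.2 := by
    have hct : ∀ k, ContinuousAt (fun s => tilt p s k) b := fun k =>
      ContinuousAt.div (continuousAt_const.mul (continuousAt_id.pow k)) (hcF 0)
        (hpos b hb0 hbρ).ne'
    have hpt : ∀ k, 0 < p k → 0 < tilt p b k := fun k hk => by
      have := hpos b hb0 hbρ
      unfold tilt; positivity
    have hFne : F.Nonempty := by
      obtain ⟨z, hz, _⟩ := hCF 0
      exact ⟨z, hz⟩
    obtain ⟨z₀, hz₀, hmin⟩ := F.exists_min_image
      (fun z => min (tilt p b z.1) (tilt p b z.2)) hFne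
    have hmpos : 0 < min (tilt p b z₀.1) (tilt p b z₀.2) :=
      lt_min (hpt _ (hF z₀ hz₀).1) (hpt _ (hF z₀ hz₀).2)
    refine ⟨min (tilt p b z₀.1) (tilt p b z₀.2) / 2, by linarith, ?_⟩
    rw [Filter.eventually_all_finset]
    intro z hz
    have h1 := hmin z hz
    have h2 := (le_min_iff.1 h1)
    have h3 := (hct z.1).eventually (lt_mem_nhds
      (show min (tilt p b z₀.1) (tilt p b z₀.2) / 2 < tilt p b z.1 by linarith [h2.1]))
    have h4 := (hct z.2).eventually (lt_mem_nhds
      (show min (tilt p b z₀.1) (tilt p b z₀.2) / 2 < tilt p b z.2 by linarith [h2.2]))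
    filter_upwards [h3, h4] with s h3 h4
    exact ⟨h3.le, h4.le⟩
  have hclose : ∀ᶠ s in 𝓝 b, |momR p 2 s - momR p 2 b| < ε / 2 := by
    have := Metric.tendsto_nhds.1 (hcR 2) (ε / 2) (by linarith)
    exact this
  have hgood : ∀ᶠ s in 𝓝 b, (0 < s ∧ s < ρ) ∧ (∀ j ∈ Finset.range 9, momR p j s ≤ K) ∧
      (∀ z ∈ F, δ ≤ tilt p s z.1 ∧ δ ≤ tilt p s z.2) ∧
      |momR p 2 s - momR p 2 b| < ε / 2 := by
    filter_upwards [Ioo_mem_nhds hb0 hbρ, hK, hδF, hclose] with s h1 h2 h3 h4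
    exact ⟨h1, h2, h3, h4⟩
  have hex_s : ∀ᶠ y in 𝓝 γ, ∃ s, ((0 < s ∧ s < ρ) ∧ (∀ j ∈ Finset.range 9, momR p j s ≤ K) ∧
      (∀ z ∈ F, δ ≤ tilt p s z.1 ∧ δ ≤ tilt p s z.2) ∧
      |momR p 2 s - momR p 2 b| < ε / 2) ∧ momR p 1 s = y := by
    rw [hγb, ← momR_map_nhds hp_nonneg hρ_conv hp_aperiodic hex b hb0 hbρ, Filter.eventually_map]
    exact hgood.mono fun s hs => ⟨s, hs, rfl⟩
  obtain ⟨d, hd, hlow⟩ := local_lower (δ / (C ^ 2 * Real.pi ^ 2)) (4 * (K + K ^ 3))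
    (by have := Real.pi_pos; positivity) (by positivity)
  have hsq : ∀ᶠ n : ℕ in atTop, K ≤ Real.sqrt n :=
    (Real.tendsto_sqrt_atTop.comp tendsto_natCast_atTop_atTop).eventually_ge_atTop K
  refine squeeze_zero' ?_ ?_ (final_asymp K d (ε / 2) (by linarith))
  · refine Eventually.of_forall fun n => div_nonneg ?_ (hZ n).le
    exact Finset.sum_nonneg fun f _ => Finset.prod_nonneg fun i _ => hp_nonneg _
  filter_upwards [hγ.eventually hex_s, hlow, hsq, eventually_ge_atTop 1] with n hn hlown hsqn hn1
  obtain ⟨s, ⟨⟨hs0, hsρ⟩, hsK, hsF, hsε⟩, hsμ⟩ := hn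
  have hn0 : (0 : ℝ) < n := by exact_mod_cast hn1
  have hs0n : 0 < Real.sqrt n := Real.sqrt_pos.2 hn0
  rw [bridgeProb_tilt p s hs0 (hpos s hs0 hsρ)]
  set q := tilt p s with hq
  have hq0 : ∀ k, 0 ≤ q k := fun k => by
    have := hpos s hs0 hsρ
    have := hp_nonneg k
    rw [hq]; unfold tilt; positivity
  have hM : ∀ j, HasSum (fun k : ℕ => q k * (k : ℝ) ^ j) (momR p j s) := fun j =>
    tilt_hasSum hp_nonneg hρ_conv j s hs0 hsρ
  have hR0 : momR p 0 s = 1 := by unfold momR; exact div_self (hpos s hs0 hsρ).ne'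
  have hq1 : HasSum q 1 := by
    have := hM 0
    rw [hR0] at this
    simpa using this
  have hKj : ∀ j, j < 9 → momR p j s ≤ K := fun j hj => hsK j (Finset.mem_range.2 hj)
  have hRn : ∀ j, 0 ≤ momR p j s := fun j => hRnn j s hs0 hsρ
  set μ := momR p 1 s with hμ
  have hμ0 : 0 ≤ μ := hRn 1
  have hμK : μ ≤ K := hKj 1 (by norm_num)
  have hxμ : (x n : ℝ) = n * μ := by rw [hsμ]; field_simp
  have c1 : HasSum (fun k : ℕ => q k * ((k : ℝ) - μ)) 0 := by
    have := (hM 1).sub (hq1.mul_left μ)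
    rw [← hμ, mul_one, sub_self] at this
    refine this.congr_fun fun k => ?_
    ring
  have c2 : HasSum (fun k : ℕ => q k * ((k : ℝ) - μ) ^ 2) (momR p 2 s - μ ^ 2) := by
    have := ((hM 2).sub ((hM 1).mul_left (2 * μ))).add (hq1.mul_left (μ ^ 2))
    rw [← hμ, show momR p 2 s - 2 * μ * μ + μ ^ 2 * 1 = momR p 2 s - μ ^ 2 by ring] at this
    have he : (fun k : ℕ => q k * ((k : ℝ) - μ) ^ 2) = fun k : ℕ =>
        q k * (k : ℝ) ^ 2 - 2 * μ * (q k * (k : ℝ) ^ 1) + μ ^ 2 * q k := by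
      funext k; ring
    rw [he]
    exact this
  have bd3 : ∀ k : ℕ, q k * |(k : ℝ) - μ| ^ 3 ≤ 4 * (q k * (k : ℝ) ^ 3) + 4 * μ ^ 3 * q k := by
    intro k
    have h1 : |(k : ℝ) - μ| ≤ k + μ := by
      rw [abs_le]; constructor <;> linarith [Nat.cast_nonneg (α := ℝ) k]
    have h2 : |(k : ℝ) - μ| ^ 3 ≤ ((k : ℝ) + μ) ^ 3 := by gcongr
    have h3 : ((k : ℝ) + μ) ^ 3 ≤ 4 * (k : ℝ) ^ 3 + 4 * μ ^ 3 := by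
      have hk := Nat.cast_nonneg (α := ℝ) k
      nlinarith [mul_nonneg (add_nonneg hk hμ0) (sq_nonneg ((k : ℝ) - μ))]
    have := mul_le_mul_of_nonneg_left (h2.trans h3) (hq0 k)
    linarith
  have s3 := ((hM 3).mul_left 4).add (hq1.mul_left (4 * μ ^ 3))
  have c3' : Summable (fun k : ℕ => q k * |(k : ℝ) - μ| ^ 3) :=
    Summable.of_nonneg_of_le (fun k => mul_nonneg (hq0 k) (by positivity)) bd3 s3.summable
  have c3 := c3'.hasSum
  have w3 : ∑' k : ℕ, q k * |(k : ℝ) - μ| ^ 3 ≤ 4 * (K + K ^ 3) := by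
    refine (hasSum_le bd3 c3 s3).trans ?_
    have := hKj 3 (by norm_num)
    have : μ ^ 3 ≤ K ^ 3 := by gcongr
    linarith
  have hKK : 0 ≤ K ^ 3 := by positivity
  have hZlow := hlown q (x n) μ _ _ hq0 hq1 hxμ c1 c2 c3
    (by have := hKj 2 (by norm_num); nlinarith [sq_nonneg μ]) w3
    (fun t ht => phi_decay hq0 hq1 C δ hC hδ F hsF hCF t ht)
  have d1 : HasSum (fun k : ℕ => q k * ((k : ℝ) ^ 2 - momR p 2 s)) 0 := by
    have := (hM 2).sub (hq1.mul_left (momR p 2 s))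
    rw [mul_one, sub_self] at this
    refine this.congr_fun fun k => ?_
    ring
  have d2 : HasSum (fun k : ℕ => q k * ((k : ℝ) ^ 2 - momR p 2 s) ^ 2)
      (momR p 4 s - momR p 2 s ^ 2) := by
    have := ((hM 4).sub ((hM 2).mul_left (2 * momR p 2 s))).add (hq1.mul_left (momR p 2 s ^ 2))
    rw [show momR p 4 s - 2 * momR p 2 s * momR p 2 s + momR p 2 s ^ 2 * 1
      = momR p 4 s - momR p 2 s ^ 2 by ring] at this
    have he : (fun k : ℕ => q k * ((k : ℝ) ^ 2 - momR p 2 s) ^ 2) = fun k : ℕ =>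
        q k * (k : ℝ) ^ 4 - 2 * momR p 2 s * (q k * (k : ℝ) ^ 2) + momR p 2 s ^ 2 * q k := by
      funext k; ring
    rw [he]
    exact this
  have hnum := numerator_le hq0 hq1 (momR p 2 s) _ (momR p 8 s) (ε / 2) d1 d2 (hM 8) n (x n) hn1
    (hRn 2) ((hKj 2 (by norm_num)).trans hsqn)
  have hnum2 : ∑ f ∈ (Finset.Nat.antidiagonalTuple n (x n)).filter
      (fun f => ε ≤ |(∑ i, (f i : ℝ) ^ 2) / n - momR p 2 b|), ∏ i, q (f i) ≤
      2 * Real.exp (K - ε / 2 * Real.sqrt n) + K / n := by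
    refine le_trans ?_ (hnum.trans ?_)
    · apply Finset.sum_le_sum_of_subset_of_nonneg
      · intro f hf
        obtain ⟨h1, h2⟩ := Finset.mem_filter.1 hf
        refine Finset.mem_filter.2 ⟨h1, ?_⟩
        have := abs_sub_le ((∑ i, (f i : ℝ) ^ 2) / n) (momR p 2 s) (momR p 2 b)
        linarith
      · intro f _ _
        exact Finset.prod_nonneg fun i _ => hq0 _
    · have h4 := hKj 4 (by norm_num)
      have h8 := hKj 8 (by norm_num)
      have h5 : momR p 4 s - momR p 2 s ^ 2 ≤ K := by nlinarith [sq_nonneg (momR p 2 s)]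
      gcongr
  unfold bridgeProb
  exact div_le_div₀ (by positivity) hnum2 (by positivity) hZlow
end

section
/- Law of large numbers for squared increments in the small endpoint regime (Proposition A.2). Assume p(0) > 0 and p(1) > 0, and that x_n → ∞ with x_n/n → 0. Then (1/x_n)·∑_{k=1}^n (X^n_k)² → 1 in probability as n → ∞. -/
set_option autoImplicit false

open Filter Topology
open scoped Classical

/-- Weight of tuples with sum `y` and `i`-th coordinate `k`. -/
noncomputable def Wt (p : ℕ → ℝ) (n : ℕ) (i : Fin n) (k y : ℕ) : ℝ :=
  ∑ f ∈ (Finset.Nat.antidiagonalTuple n y).filter (fun f => f i = k), ∏ j, p (f j)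

lemma sum_update_add {n : ℕ} (f : Fin n → ℕ) (i : Fin n) (b : ℕ) :
    (∑ j, Function.update f i b j) + f i = (∑ j, f j) + b := by
  rw [Finset.sum_update_of_mem (Finset.mem_univ i), ← Finset.sum_sdiff (Finset.subset_univ {i}) (f := f)]
  simp only [Finset.sum_singleton]
  omega

lemma prod_update_mul (p : ℕ → ℝ) {n : ℕ} (f : Fin n → ℕ) (i : Fin n) (b : ℕ) :
    (∏ j, p (Function.update f i b j)) * p (f i) = (∏ j, p (f j)) * p b := by
  rw [← Finset.mul_prod_erase Finset.univ (fun j => p (Function.update f i b j)) (Finset.mem_univ i),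
    ← Finset.mul_prod_erase Finset.univ (fun j => p (f j)) (Finset.mem_univ i)]
  have : ∏ j ∈ Finset.univ.erase i, p (Function.update f i b j)
      = ∏ j ∈ Finset.univ.erase i, p (f j) := by
    apply Finset.prod_congr rfl
    intro j hj
    rw [Function.update_of_ne (Finset.ne_of_mem_erase hj)]
  rw [this]
  simp only [Function.update_self]
  ring

lemma Wt_shift (p : ℕ → ℝ) (n : ℕ) (i : Fin n) (k y : ℕ) :
    p 0 * Wt p n i k (y + k) = p k * Wt p n i 0 y := by
  unfold Wt
  rw [Finset.mul_sum, Finset.mul_sum]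
  refine Finset.sum_bij' (fun f _ => Function.update f i 0) (fun f _ => Function.update f i k)
    ?_ ?_ ?_ ?_ ?_
  · intro f hf
    simp only [Finset.mem_filter, Finset.Nat.mem_antidiagonalTuple] at hf ⊢
    have := sum_update_add f i 0
    refine ⟨by omega, by simp⟩
  · intro f hf
    simp only [Finset.mem_filter, Finset.Nat.mem_antidiagonalTuple] at hf ⊢
    have := sum_update_add f i k
    refine ⟨by omega, by simp⟩
  · intro f hf
    simp only [Finset.mem_filter] at hf
    simp [← hf.2]
  · intro f hf
    simp only [Finset.mem_filter] at hf
    simp [← hf.2]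
  · intro f hf
    simp only [Finset.mem_filter] at hf
    have := prod_update_mul p f i 0
    rw [hf.2] at this
    linarith

lemma prod_nonneg_p (p : ℕ → ℝ) (hp : ∀ k, 0 ≤ p k) {n : ℕ} (f : Fin n → ℕ) :
    0 ≤ ∏ j, p (f j) := Finset.prod_nonneg fun _ _ => hp _

lemma Zweight_nonneg (p : ℕ → ℝ) (hp : ∀ k, 0 ≤ p k) (n y : ℕ) : 0 ≤ Zweight p n y :=
  Finset.sum_nonneg fun f _ => prod_nonneg_p p hp f

lemma Wt_le (p : ℕ → ℝ) (hp : ∀ k, 0 ≤ p k) (n : ℕ) (i : Fin n) (k y : ℕ) :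
    Wt p n i k y ≤ Zweight p n y :=
  Finset.sum_le_sum_of_subset_of_nonneg (Finset.filter_subset _ _)
    fun f _ _ => prod_nonneg_p p hp f

lemma sum_Wt (p : ℕ → ℝ) (n k y : ℕ) :
    ∑ i, Wt p n i k y = ∑ f ∈ Finset.Nat.antidiagonalTuple n y,
      (∏ j, p (f j)) * ((Finset.univ.filter (fun i => f i = k)).card : ℝ) := by
  unfold Wt
  simp_rw [Finset.sum_filter]
  rw [Finset.sum_comm]
  apply Finset.sum_congr rfl
  intro f _
  rw [← Finset.sum_filter, Finset.sum_const, nsmul_eq_mul, mul_comm]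

lemma card_one_le {n y : ℕ} (f : Fin n → ℕ) (hf : ∑ i, f i = y) :
    (Finset.univ.filter (fun i => f i = 1)).card ≤ y := by
  rw [← hf, Finset.card_filter]
  apply Finset.sum_le_sum
  intro i _
  split_ifs <;> omega

lemma card_zero_ge {n y : ℕ} (f : Fin n → ℕ) (hf : ∑ i, f i = y) :
    n ≤ (Finset.univ.filter (fun i => f i = 0)).card + y := by
  rw [← hf, Finset.card_filter, ← Finset.sum_add_distrib]
  calc n = ∑ i : Fin n, 1 := by simp
    _ ≤ _ := by
      apply Finset.sum_le_sum
      intro i _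
      split_ifs <;> omega

lemma Z_step (p : ℕ → ℝ) (hp : ∀ k, 0 ≤ p k) (n y : ℕ) :
    p 1 * (((n : ℝ) - y) * Zweight p n y) ≤ p 0 * (((y + 1 : ℕ) : ℝ) * Zweight p n (y + 1)) := by
  have h1 : ((n : ℝ) - y) * Zweight p n y ≤ ∑ i, Wt p n i 0 y := by
    rw [sum_Wt, Zweight, Finset.mul_sum]
    apply Finset.sum_le_sum
    intro f hf
    rw [Finset.Nat.mem_antidiagonalTuple] at hf
    rw [mul_comm]
    apply mul_le_mul_of_nonneg_left _ (prod_nonneg_p p hp f)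
    have : (n : ℝ) ≤ ((Finset.univ.filter (fun i => f i = 0)).card : ℝ) + y := by
      exact_mod_cast card_zero_ge f hf
    linarith
  have h2 : ∑ i, Wt p n i 1 (y + 1) ≤ ((y + 1 : ℕ) : ℝ) * Zweight p n (y + 1) := by
    rw [sum_Wt, Zweight, Finset.mul_sum]
    apply Finset.sum_le_sum
    intro f hf
    rw [Finset.Nat.mem_antidiagonalTuple] at hf
    rw [mul_comm]
    apply mul_le_mul_of_nonneg_right _ (prod_nonneg_p p hp f)
    exact_mod_cast card_one_le f hf
  calc _ ≤ p 1 * ∑ i, Wt p n i 0 y := mul_le_mul_of_nonneg_left h1 (hp 1)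
    _ = p 0 * ∑ i, Wt p n i 1 (y + 1) := by
      rw [Finset.mul_sum, Finset.mul_sum]
      exact Finset.sum_congr rfl fun i _ => (Wt_shift p n i 1 y).symm
    _ ≤ _ := mul_le_mul_of_nonneg_left h2 (hp 0)

lemma Z_le (p : ℕ → ℝ) (hp : ∀ k, 0 ≤ p k) (hp1 : 0 < p 1) (n x : ℕ) (hx : 0 < x)
    (hn : 2 * x ≤ n) (k y : ℕ) (hk : y + k = x) :
    Zweight p n y ≤ (2 * p 0 / p 1 * ((x : ℝ) / n)) ^ k * Zweight p n x := by
  induction k generalizing y with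
  | zero => simp at hk; simp [hk]
  | succ k ih =>
    have h1 := ih (y + 1) (by omega)
    have h2 := Z_step p hp n y
    have hn0 : (0 : ℝ) < n := by exact_mod_cast (by omega : 0 < n)
    set r := 2 * p 0 / p 1 * ((x : ℝ) / n) with hr
    have hr0 : 0 ≤ r := by have := hp 0; positivity
    have hA := Zweight_nonneg p hp n y
    have hB := Zweight_nonneg p hp n (y + 1)
    have h3 : Zweight p n y ≤ r * Zweight p n (y + 1) := by
      have ha : (n : ℝ) / 2 ≤ n - y := by
        have : 2 * (y : ℝ) ≤ n := by exact_mod_cast (by omega : 2 * y ≤ n)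
        linarith
      have hb : ((y + 1 : ℕ) : ℝ) ≤ x := by exact_mod_cast (by omega : y + 1 ≤ x)
      have h4 : p 1 * ((n : ℝ) / 2 * Zweight p n y) ≤ p 0 * (x * Zweight p n (y + 1)) := by
        calc _ ≤ _ := mul_le_mul_of_nonneg_left (mul_le_mul_of_nonneg_right ha hA) (hp 1)
          _ ≤ _ := h2
          _ ≤ _ := mul_le_mul_of_nonneg_left (mul_le_mul_of_nonneg_right hb hB) (hp 0)
      have h5 : r * Zweight p n (y + 1) = p 0 * (x * Zweight p n (y + 1)) / (p 1 * (n / 2)) := by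
        rw [hr]; field_simp
      rw [h5, le_div_iff₀ (by positivity)]
      linarith
    calc _ ≤ _ := h3
      _ ≤ r * (r ^ k * Zweight p n x) := mul_le_mul_of_nonneg_left h1 hr0
      _ = _ := by ring

lemma moment_eq (p : ℕ → ℝ) (n x : ℕ) :
    ∑ f ∈ Finset.Nat.antidiagonalTuple n x,
      (∏ j, p (f j)) * ∑ i, (f i : ℝ) * ((f i : ℝ) - 1)
    = ∑ i, ∑ k ∈ Finset.range (x + 1), (k : ℝ) * ((k : ℝ) - 1) * Wt p n i k x := by
  unfold Wt
  simp_rw [Finset.mul_sum]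
  rw [Finset.sum_comm]
  apply Finset.sum_congr rfl
  intro i _
  have hmaps : ∀ f ∈ Finset.Nat.antidiagonalTuple n x, f i ∈ Finset.range (x + 1) := by
    intro f hf
    rw [Finset.Nat.mem_antidiagonalTuple] at hf
    rw [Finset.mem_range, ← hf]
    exact Nat.lt_succ_of_le (Finset.single_le_sum (f := f) (fun _ _ => Nat.zero_le _)
      (Finset.mem_univ i))
  rw [← Finset.sum_fiberwise_of_maps_to hmaps]
  apply Finset.sum_congr rfl
  intro k _
  apply Finset.sum_congr rfl
  intro f hf
  rw [Finset.mem_filter] at hf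
  rw [hf.2]
  ring

lemma moment_le (p : ℕ → ℝ) (hp : ∀ k, 0 ≤ p k) (hp0 : 0 < p 0) (hp1 : 0 < p 1) (n x : ℕ)
    (hx : 0 < x) (hn : 2 * x ≤ n) (s : ℝ) (hs : 0 < s)
    (hsum : Summable (fun k : ℕ => (k : ℝ) ^ 2 * (p k * s ^ k)))
    (hr : 2 * p 0 / p 1 * ((x : ℝ) / n) ≤ s) :
    ∑ f ∈ Finset.Nat.antidiagonalTuple n x,
      (∏ j, p (f j)) * ∑ i, (f i : ℝ) * ((f i : ℝ) - 1)
    ≤ n * (1 / p 0 * ((2 * p 0 / p 1 * ((x : ℝ) / n)) / s) ^ 2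
        * (∑' k : ℕ, (k : ℝ) ^ 2 * (p k * s ^ k)) * Zweight p n x) := by
  rw [moment_eq]
  set r := 2 * p 0 / p 1 * ((x : ℝ) / n) with hrdef
  have hr0 : 0 ≤ r := by positivity
  have hZ := Zweight_nonneg p hp n x
  have hrs : r / s ≤ 1 := by rw [div_le_one hs]; exact hr
  have hrs0 : 0 ≤ r / s := by positivity
  have key : ∀ i : Fin n, ∑ k ∈ Finset.range (x + 1), (k : ℝ) * ((k : ℝ) - 1) * Wt p n i k x
      ≤ 1 / p 0 * (r / s) ^ 2 * (∑' k : ℕ, (k : ℝ) ^ 2 * (p k * s ^ k)) * Zweight p n x := by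
    intro i
    have hterm : ∀ k ∈ Finset.range (x + 1), (k : ℝ) * ((k : ℝ) - 1) * Wt p n i k x
        ≤ 1 / p 0 * (r / s) ^ 2 * Zweight p n x * ((k : ℝ) ^ 2 * (p k * s ^ k)) := by
      intro k hk
      have hpk := hp k
      rcases Nat.lt_or_ge k 2 with h | h
      · have : (k : ℝ) * ((k : ℝ) - 1) = 0 := by
          interval_cases k <;> simp
        rw [this, zero_mul]
        positivity
      · rw [Finset.mem_range] at hk
        obtain ⟨y, hy⟩ : ∃ y, y + k = x := ⟨x - k, by omega⟩
        have h1 := Wt_shift p n i k y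
        rw [hy] at h1
        have h2 : Wt p n i k x ≤ 1 / p 0 * (p k * (r ^ k * Zweight p n x)) := by
          have : Wt p n i k x = 1 / p 0 * (p k * Wt p n i 0 y) := by
            rw [← h1]; field_simp
          rw [this]
          have h3 := (Wt_le p hp n i 0 y).trans (Z_le p hp hp1 n x hx hn k y hy)
          gcongr
        have h4 : r ^ k ≤ (r / s) ^ 2 * s ^ k := by
          have : r ^ k = (r / s) ^ k * s ^ k := by
            rw [← mul_pow]; congr 1; field_simp
          rw [this]
          exact mul_le_mul_of_nonneg_right (pow_le_pow_of_le_one hrs0 hrs h) (by positivity)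
        have hk1 : (2 : ℝ) ≤ k := by exact_mod_cast h
        have h5 : (k : ℝ) * ((k : ℝ) - 1) ≤ (k : ℝ) ^ 2 := by nlinarith
        have h6 : 0 ≤ (k : ℝ) * ((k : ℝ) - 1) := by nlinarith
        calc _ ≤ (k : ℝ) * ((k : ℝ) - 1) * (1 / p 0 * (p k * (r ^ k * Zweight p n x))) :=
              mul_le_mul_of_nonneg_left h2 h6
          _ ≤ (k : ℝ) ^ 2 * (1 / p 0 * (p k * (r ^ k * Zweight p n x))) :=
              mul_le_mul_of_nonneg_right h5 (by positivity)
          _ ≤ (k : ℝ) ^ 2 * (1 / p 0 * (p k * ((r / s) ^ 2 * s ^ k * Zweight p n x))) := by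
              gcongr
          _ = _ := by ring
    calc _ ≤ _ := Finset.sum_le_sum hterm
      _ = 1 / p 0 * (r / s) ^ 2 * Zweight p n x
          * ∑ k ∈ Finset.range (x + 1), ((k : ℝ) ^ 2 * (p k * s ^ k)) := by
          rw [Finset.mul_sum]
      _ ≤ 1 / p 0 * (r / s) ^ 2 * Zweight p n x * ∑' k : ℕ, (k : ℝ) ^ 2 * (p k * s ^ k) := by
          apply mul_le_mul_of_nonneg_left _ (by positivity)
          apply hsum.sum_le_tsum
          intro k _
          have := hp k
          positivity
      _ = _ := by ring
  calc _ ≤ ∑ _i : Fin n, _ := Finset.sum_le_sum fun i _ => key i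
    _ = _ := by rw [Finset.sum_const, Finset.card_univ, Fintype.card_fin, nsmul_eq_mul]

lemma markov_bound (p : ℕ → ℝ) (hp : ∀ k, 0 ≤ p k) (n x : ℕ) (hx : 0 < x)
    (hZ : 0 < Zweight p n x) (ε : ℝ) (hε : 0 < ε) (M : ℝ)
    (hM : ∑ f ∈ Finset.Nat.antidiagonalTuple n x,
      (∏ j, p (f j)) * ∑ i, (f i : ℝ) * ((f i : ℝ) - 1) ≤ M * Zweight p n x) :
    bridgeProb p n x (fun f => ε ≤ |(∑ i, (f i : ℝ) ^ 2) / (x : ℝ) - 1|) ≤ M / (ε * x) := by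
  have hx' : (0 : ℝ) < x := by exact_mod_cast hx
  unfold bridgeProb
  rw [div_le_div_iff₀ hZ (by positivity)]
  refine le_trans ?_ hM
  rw [Finset.sum_mul, Finset.sum_filter]
  apply Finset.sum_le_sum
  intro f hf
  rw [Finset.Nat.mem_antidiagonalTuple] at hf
  have hnn : 0 ≤ ∑ i, (f i : ℝ) * ((f i : ℝ) - 1) := by
    apply Finset.sum_nonneg
    intro i _
    rcases Nat.eq_zero_or_pos (f i) with h | h
    · simp [h]
    · have : (1 : ℝ) ≤ f i := by exact_mod_cast h
      nlinarith
  have hw := prod_nonneg_p p hp f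
  split_ifs with h
  · apply mul_le_mul_of_nonneg_left _ hw
    have e : (∑ i, (f i : ℝ) ^ 2) / (x : ℝ) - 1 = (∑ i, (f i : ℝ) * ((f i : ℝ) - 1)) / x := by
      have h1 : ∑ i, (f i : ℝ) * ((f i : ℝ) - 1) = ∑ i, (f i : ℝ) ^ 2 - x := by
        rw [← hf]
        push_cast
        rw [← Finset.sum_sub_distrib]
        exact Finset.sum_congr rfl fun i _ => by ring
      rw [h1]; field_simp
    rw [e, abs_of_nonneg (by positivity), le_div_iff₀ hx'] at h
    exact h
  · positivity

lemma summable_sq (p : ℕ → ℝ) (hp : ∀ k, 0 ≤ p k) (s t : ℝ) (hs : 0 < s) (hst : s < t)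
    (ht : Summable (fun k : ℕ => p k * t ^ k)) :
    Summable (fun k : ℕ => (k : ℝ) ^ 2 * (p k * s ^ k)) := by
  have ht0 : 0 < t := hs.trans hst
  have hg : Summable (fun k : ℕ => (k : ℝ) ^ 2 * (s / t) ^ k) := by
    apply summable_pow_mul_geometric_of_norm_lt_one
    rw [Real.norm_of_nonneg (by positivity), div_lt_one ht0]
    exact hst
  refine Summable.of_nonneg_of_le ?_ ?_ (hg.mul_left (∑' k : ℕ, p k * t ^ k))
  · intro k
    have := hp k
    positivity
  · intro k
    have h1 : p k * t ^ k ≤ ∑' k : ℕ, p k * t ^ k :=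
      ht.le_tsum k fun j _ => mul_nonneg (hp j) (by positivity)
    have h2 : (k : ℝ) ^ 2 * (p k * s ^ k) = p k * t ^ k * ((k : ℝ) ^ 2 * (s / t) ^ k) := by
      rw [div_pow]; field_simp
    rw [h2]
    exact mul_le_mul_of_nonneg_right h1 (by positivity)

/-- **Law of large numbers for squared increments in the small endpoint regime**
(Proposition A.2): if `p 0, p 1 > 0`, `x_n → ∞`, `x_n/n → 0`, then under `P^{p,n}_{x_n}`,
`(1/x_n)∑ (X^n_k)² → 1` in probability. -/
theorem squares_lln_small_endpoint
    (p : ℕ → ℝ) (hp_nonneg : ∀ k, 0 ≤ p k)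
    (hp_aperiodic : ¬ ∃ (a h : ℤ), 2 ≤ h ∧ ∀ k : ℕ, 0 < p k → h ∣ ((k : ℤ) - a))
    (ρ : ℝ) (hρ : 0 < ρ)
    (hρ_conv : ∀ s : ℝ, 0 ≤ s → s < ρ → Summable (fun k : ℕ => p k * s ^ k))
    (hρ_div : ∀ s : ℝ, ρ < s → ¬ Summable (fun k : ℕ => p k * s ^ k))
    (hp0 : 0 < p 0) (hp1 : 0 < p 1)
    (x : ℕ → ℕ) (hZ : ∀ n, 0 < Zweight p n (x n))
    (hx_infty : Tendsto (fun n : ℕ => (x n : ℝ)) atTop atTop)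
    (hx_small : Tendsto (fun n : ℕ => (x n : ℝ) / n) atTop (𝓝 0)) :
    ∀ ε > 0, Tendsto (fun n : ℕ =>
      bridgeProb p n (x n) (fun f => ε ≤ |(∑ i, (f i : ℝ) ^ 2) / (x n : ℝ) - 1|))
      atTop (𝓝 0) := by
  intro ε hε
  have hs : 0 < ρ / 3 := by positivity
  have hsum := summable_sq p hp_nonneg (ρ / 3) (ρ / 2) hs (by linarith)
    (hρ_conv _ (by positivity) (by linarith))
  set K := ∑' k : ℕ, (k : ℝ) ^ 2 * (p k * (ρ / 3) ^ k) with hK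
  set c := 2 * p 0 / p 1 with hc
  have hc0 : 0 < c := by positivity
  have hlim : Tendsto (fun n : ℕ => (1 / p 0 * (c / (ρ / 3)) ^ 2 * K / ε) * ((x n : ℝ) / n))
      atTop (𝓝 0) := by
    simpa using hx_small.const_mul (1 / p 0 * (c / (ρ / 3)) ^ 2 * K / ε)
  have hr : ∀ᶠ n : ℕ in atTop, c * ((x n : ℝ) / n) < ρ / 3 := by
    have : Tendsto (fun n : ℕ => c * ((x n : ℝ) / n)) atTop (𝓝 0) := by
      simpa using hx_small.const_mul c
    exact this.eventually_lt_const hs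
  refine tendsto_of_tendsto_of_tendsto_of_le_of_le' tendsto_const_nhds hlim ?_ ?_
  · refine Eventually.of_forall fun n => ?_
    exact div_nonneg (Finset.sum_nonneg fun f _ => prod_nonneg_p p hp_nonneg f) (hZ n).le
  · filter_upwards [hr, hx_infty.eventually_gt_atTop 0,
      hx_small.eventually_lt_const (by norm_num : (0 : ℝ) < 1 / 2), eventually_gt_atTop 0]
      with n h1 h2 h3 h4
    have hn0 : (0 : ℝ) < n := by exact_mod_cast h4
    have hx0 : 0 < x n := by exact_mod_cast h2
    have hn : 2 * x n ≤ n := by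
      rw [div_lt_iff₀ hn0] at h3
      have : 2 * (x n : ℝ) ≤ n := by linarith
      exact_mod_cast this
    have hm := moment_le p hp_nonneg hp0 hp1 n (x n) hx0 hn (ρ / 3) hs hsum h1.le
    rw [← mul_assoc] at hm
    refine (markov_bound p hp_nonneg n (x n) hx0 (hZ n) ε hε _ hm).trans (le_of_eq ?_)
    rw [← hK, ← hc]
    field_simp
end
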